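/- Let G be a countable infinite amenable group and let P be a polyhedron with 0 < dim P < ∞. For every ρ with 0 < ρ < 1, there exists a minimal closed subshift X ⊆ P^G with mean topological dimension mdim(X,G) = ρ · dim P. -/

import Mathlib

open Filter Topology Pointwise ENNReal

/-- A Følner sequence for a group `G`. -/
def IsFolnerSeq (G : Type*) [Group G] (F : ℕ → Finset G) : Prop :=
  (∀ n, (F n).Nonempty) ∧
    ∀ g : G, Filter.Tendsto
      (fun n => ((symmDiff (g • ((F n) : Set G)) ((F n) : Set G)).ncard : ℝ) / (F n).card)
      Filter.atTop (nhds 0)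

/-- A group is amenable if it admits a Følner sequence. -/
def IsAmenable (G : Type*) [Group G] : Prop := ∃ F : ℕ → Finset G, IsFolnerSeq G F

variable {G : Type*} [Group G]

/-- The `K`-boundary of a finite set `A`. -/
def kBoundary (A K : Finset G) : Set G :=
  {g : G | (∃ k ∈ K, k * g ∈ A) ∧ ∃ k ∈ K, k * g ∉ A}

/-- `A` is `(K, δ)`-invariant. -/
def InvariantSet (A K : Finset G) (δ : ℝ) : Prop :=
  ((kBoundary A K).ncard : ℝ) < δ * A.card

/-- A subset of a group is syndetic if finitely many translates cover the group. -/
def Syndetic (A : Set G) : Prop := ∃ F : Finset G, (F : Set G) * A = Set.univ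

/-- A finite tiling of a group `G`: a partition of `G` into right translates of
finitely many finite shapes, each shape containing the identity. -/
structure FiniteTiling (G : Type*) [Group G] where
  tiles : Set (Set G)
  shapes : Finset (Finset G)
  covers : ∀ g : G, ∃! t, t ∈ tiles ∧ g ∈ t
  tile_shape : ∀ t ∈ tiles, ∃ S ∈ shapes, ∃ c : G, t = (S : Set G) * {c}
  one_mem_shape : ∀ S ∈ shapes, (1 : G) ∈ S

/-- The set of centers of a shape `S` in a tiling. -/
def FiniteTiling.center (T : FiniteTiling G) (S : Finset G) : Set G :=
  {c : G | ((S : Set G) * {c}) ∈ T.tiles}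

/-- A finite tiling is irreducible if every sufficiently invariant finite set
contains a tile of every shape. -/
def FiniteTiling.IsIrreducible (T : FiniteTiling G) : Prop :=
  ∃ (T₀ : Finset G) (ε : ℝ), 0 < ε ∧
    ∀ F : Finset G, InvariantSet F T₀ ε →
      ∀ S ∈ T.shapes, ∃ c ∈ T.center S, (S : Set G) * {c} ⊆ (F : Set G)

/-- The shift action of `G` on `A^G`: `(c • x) g = x (g * c)`. -/
def shiftAct {A : Type*} (c : G) (x : G → A) : G → A := fun g => x (g * c)

instance : TopologicalSpace (Option (Finset G)) := ⊥

open Classical in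
/-- The point of `(S(T) ∪ {0})^G` encoding the centers of a tiling. -/
noncomputable def FiniteTiling.point (T : FiniteTiling G) : G → Option (Finset G) :=
  fun g => if h : ∃ S, S ∈ T.shapes ∧ g ∈ T.center S then some h.choose else none

/-- The subshift associated with a finite tiling: the orbit closure of `T.point`. -/
noncomputable def FiniteTiling.subshift (T : FiniteTiling G) : Set (G → Option (Finset G)) :=
  closure (Set.range fun c : G => shiftAct c T.point)

/-- `T₂` is primely congruent with `T₁`: tiles of `T₂` are unions of tiles of `T₁`
and each shape of `T₂` has a unique master partition by tiles of `T₁`. -/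
def PrimelyCongruent (T₁ T₂ : FiniteTiling G) : Prop :=
  (∀ t₁ ∈ T₁.tiles, ∀ t₂ ∈ T₂.tiles, (t₁ ∩ t₂).Nonempty → t₁ ⊆ t₂) ∧
  ∀ S ∈ T₂.shapes, ∀ c c' : G, c ∈ T₂.center S → c' ∈ T₂.center S →
    {u : Set G | ∃ t ∈ T₁.tiles, t ⊆ (S : Set G) * {c} ∧ u = t * {c⁻¹}} =
    {u : Set G | ∃ t ∈ T₁.tiles, t ⊆ (S : Set G) * {c'} ∧ u = t * {c'⁻¹}}

/-- Number of patterns of a subshift on a finite window `F`. -/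
noncomputable def patternCount {A : Type*} (X : Set (G → A)) (F : Finset G) : ℕ :=
  {p : ↑F → A | ∃ x ∈ X, ∀ g : ↑F, x (g : G) = p g}.ncard

section Dim

variable {Y : Type*} [TopologicalSpace Y]

/-- `β` is a finite open cover of the set `X`. -/
def IsOpenCoverOf (X : Set Y) (β : Finset (Set Y)) : Prop :=
  (∀ U ∈ β, IsOpen U) ∧ X ⊆ ⋃ U ∈ β, U

/-- The order of a finite cover on a set `X`. -/
noncomputable def ordOn (X : Set Y) (β : Finset (Set Y)) : ℕ :=
  ⨆ y : X, ({U : Set Y | U ∈ β ∧ (y : Y) ∈ U}.ncard - 1)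

/-- `D(α)`: minimal order among finite open covers of `X` refining `α`. -/
noncomputable def Dcov (X : Set Y) (α : Finset (Set Y)) : ℕ :=
  sInf {n | ∃ β : Finset (Set Y), IsOpenCoverOf X β ∧
    (∀ U ∈ β, ∃ V ∈ α, U ⊆ V) ∧ ordOn X β = n}

/-- The topological (covering) dimension of a subset `X` of a topological space. -/
noncomputable def topDim (X : Set Y) : ℕ∞ :=
  ⨆ α ∈ {α : Finset (Set Y) | IsOpenCoverOf X α}, (Dcov X α : ℕ∞)

/-- The join `⋁_{g ∈ F} (σ g)⁻¹ α` of the pullbacks of a finite cover along an action. -/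
noncomputable def FCover {H : Type*} (σ : H → Y → Y) (F : Finset H) (α : Finset (Set Y)) :
    Finset (Set Y) :=
  letI := Classical.decEq H
  letI := Classical.decEq (Set Y)
  (F.pi fun _ => α).image fun f => ⋂ g, ⋂ (h : g ∈ F), σ g ⁻¹' f g h

/-- Mean topological dimension of `X` with respect to an action `σ` of `G`,
computed along the Følner sequence `Fo`. -/
noncomputable def mdim {H : Type*} (σ : H → Y → Y) (X : Set Y) (Fo : ℕ → Finset H) : ℝ≥0∞ :=
  ⨆ α ∈ {α : Finset (Set Y) | IsOpenCoverOf X α},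
    Filter.limsup
      (fun n => (Dcov X (FCover σ (Fo n) α) : ℝ≥0∞) / ((Fo n).card : ℝ≥0∞))
      Filter.atTop

end Dim

/-- A polyhedron: a finite union of simplices (convex hulls of finite sets) in a
Euclidean space. -/
def IsPolyhedron {N : ℕ} (P : Set (EuclideanSpace ℝ (Fin N))) : Prop :=
  ∃ S : Finset (Finset (EuclideanSpace ℝ (Fin N))),
    P = ⋃ s ∈ S, convexHull ℝ (s : Set (EuclideanSpace ℝ (Fin N)))

/-- The upper (Banach) density of a subset of an amenable group. -/
noncomputable def upperDensity (G : Type*) [Group G] (J : Set G) : ℝ :=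
  sSup {r : ℝ | ∃ Fo : ℕ → Finset G, IsFolnerSeq G Fo ∧
    r = Filter.limsup (fun n => ((J ∩ (Fo n : Set G)).ncard : ℝ) / (Fo n).card) Filter.atTop}

section Sperner

/-- Among the labels of the vertices `0, …, m + 1` of a simplex, the number of facets carrying
all of the labels `0, …, m` has the parity of the completeness of the labelling. -/
theorem card_doors_mod_two (m : ℕ) (g : ℕ → ℕ) (hg : ∀ i ≤ m + 1, g i ≤ m + 1) :
    (((Finset.range (m + 2)).filter
      fun j => ∀ a ≤ m, ∃ i ≤ m + 1, i ≠ j ∧ g i = a).card : ZMod 2) =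
    if ∀ a ≤ m + 1, ∃ i ≤ m + 1, g i = a then 1 else 0 := by
  classical
  by_cases hdoor : ∃ j ≤ m + 1, ∀ a ≤ m, ∃ i ≤ m + 1, i ≠ j ∧ g i = a
  · obtain ⟨j, hj, hja⟩ := hdoor
    have hcard : ((Finset.range (m + 2)).erase j).card = m + 1 := by
      rw [Finset.card_erase_of_mem (by simp; omega)]; simp
    have hinj : ∀ i ≤ m + 1, i ≠ j → ∀ i' ≤ m + 1, i' ≠ j → g i = g i' → i = i' := by
      have hs : Finset.range (m + 1) ⊆ ((Finset.range (m + 2)).erase j).image g := by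
        intro a ha
        obtain ⟨i, hi, hij, rfl⟩ := hja a (by simpa [Nat.lt_succ_iff] using ha)
        exact Finset.mem_image.2 ⟨i, by simp [hij]; omega, rfl⟩
      have hio : Set.InjOn g ((Finset.range (m + 2)).erase j : Finset ℕ) := by
        apply Finset.card_image_iff.1
        have h1 := Finset.card_le_card hs
        have h3 := Finset.card_image_le (s := (Finset.range (m + 2)).erase j) (f := g)
        simp only [Finset.card_range] at h1
        omega
      intro i hi hij i' hi' hij' h
      exact hio (by simp [hij]; omega) (by simp [hij']; omega) h
    have hle : ∀ i ≤ m + 1, i ≠ j → g i ≤ m := by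
      intro i hi hij
      by_contra hcon
      have hs : Finset.range (m + 1) ⊆ (((Finset.range (m + 2)).erase j).erase i).image g := by
        intro a ha
        obtain ⟨l, hl, hlj, rfl⟩ := hja a (by simpa [Nat.lt_succ_iff] using ha)
        refine Finset.mem_image.2 ⟨l, ?_, rfl⟩
        have hla : g l < m + 1 := by simpa using ha
        have : l ≠ i := by rintro rfl; omega
        simp [hlj, this]; omega
      have h1 := Finset.card_le_card hs
      have h2 := Finset.card_image_le
        (s := ((Finset.range (m + 2)).erase j).erase i) (f := g)
      rw [Finset.card_erase_of_mem (by simp [hij]; omega), hcard] at h2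
      simp at h1 h2
      omega
    by_cases hgj : g j = m + 1
    · have hf : (Finset.range (m + 2)).filter
          (fun j => ∀ a ≤ m, ∃ i ≤ m + 1, i ≠ j ∧ g i = a) = {j} := by
        ext i
        simp only [Finset.mem_filter, Finset.mem_range, Finset.mem_singleton]
        constructor
        · rintro ⟨hi, hi2⟩
          by_contra hij
          obtain ⟨l, hl, hli, hgl⟩ := hi2 _ (hle i (by omega) hij)
          by_cases hlj : l = j
          · have := hle i (by omega) hij
            subst hlj; omega
          · exact hli (hinj l hl hlj i (by omega) hij hgl)
        · rintro rfl
          exact ⟨by omega, hja⟩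
      rw [hf, if_pos]
      · simp
      · intro a ha
        rcases Nat.lt_or_ge a (m + 1) with h | h
        · obtain ⟨i, hi, -, hgi⟩ := hja a (by omega)
          exact ⟨i, hi, hgi⟩
        · exact ⟨j, hj, by omega⟩
    · have hgj' : g j ≤ m := by have := hg j hj; omega
      obtain ⟨i₀, hi₀, hi₀j, hgi₀⟩ := hja _ hgj'
      have hf : (Finset.range (m + 2)).filter
          (fun j => ∀ a ≤ m, ∃ i ≤ m + 1, i ≠ j ∧ g i = a) = {j, i₀} := by
        ext i
        simp only [Finset.mem_filter, Finset.mem_range, Finset.mem_singleton, Finset.mem_insert]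
        constructor
        · rintro ⟨hi, hi2⟩
          by_contra! hij
          obtain ⟨l, hl, hli, hgl⟩ := hi2 _ (hle i (by omega) hij.1)
          by_cases hlj : l = j
          · subst hlj
            exact hij.2 (hinj i (by omega) hij.1 i₀ hi₀ hi₀j (by omega))
          · exact hli (hinj l hl hlj i (by omega) hij.1 hgl)
        · rintro (rfl | rfl)
          · exact ⟨by omega, hja⟩
          · refine ⟨by omega, fun a ha => ?_⟩
            obtain ⟨l, hl, hlj, hgl⟩ := hja a ha
            by_cases hli : l = i
            · exact ⟨j, hj, hi₀j.symm, by rw [← hgl, hli, hgi₀]⟩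
            · exact ⟨l, hl, hli, hgl⟩
      rw [hf, if_neg]
      · rw [Finset.card_pair hi₀j.symm]; rfl
      · intro h
        obtain ⟨l, hl, hgl⟩ := h (m + 1) le_rfl
        have hlj : l ≠ j := by rintro rfl; omega
        have := hle l hl hlj
        omega
  · rw [if_neg, Finset.filter_false_of_mem]
    · simp
    · intro j hj h
      exact hdoor ⟨j, by simpa [Nat.lt_succ_iff] using hj, h⟩
    · intro h
      obtain ⟨j, hj, hgj⟩ := h (m + 1) le_rfl
      refine hdoor ⟨j, hj, fun a ha => ?_⟩
      obtain ⟨i, hi, hgi⟩ := h a (by omega)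
      exact ⟨i, hi, by rintro rfl; omega, hgi⟩

/-- The `j`-th vertex of the Kuhn simplex with base point `y` whose order of coordinate
increments is recorded by `σ`. -/
def kuhnVertex {n : ℕ} (y σ : Fin n → ℕ) (j : ℕ) : Fin n → ℕ :=
  fun a => y a + if σ a < j then 1 else 0

open Classical in
/-- The Kuhn simplices of the grid `{0, …, k}ⁿ` that lie in the face spanned by the first `m`
coordinates. -/
noncomputable def kuhnSimplices (n k m : ℕ) : Finset ((Fin n → ℕ) × (Fin n → ℕ)) :=
  (Fintype.piFinset (fun _ => Finset.range (k + 1)) ×ˢ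
      Fintype.piFinset (fun _ => Finset.range (n + 1))).filter fun s =>
    (∀ a : Fin n, (a : ℕ) < m → s.1 a < k ∧ s.2 a < m) ∧
    (∀ a : Fin n, m ≤ (a : ℕ) → s.1 a = 0 ∧ s.2 a = n) ∧
    (∀ a b : Fin n, (a : ℕ) < m → (b : ℕ) < m → s.2 a = s.2 b → a = b)

theorem mem_kuhnSimplices {n k m : ℕ} (hm : m ≤ n) (s : (Fin n → ℕ) × (Fin n → ℕ)) :
    s ∈ kuhnSimplices n k m ↔
      (∀ a : Fin n, (a : ℕ) < m → s.1 a < k ∧ s.2 a < m) ∧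
      (∀ a : Fin n, m ≤ (a : ℕ) → s.1 a = 0 ∧ s.2 a = n) ∧
      (∀ a b : Fin n, (a : ℕ) < m → (b : ℕ) < m → s.2 a = s.2 b → a = b) := by
  classical
  simp only [kuhnSimplices, Finset.mem_filter, Finset.mem_product, Fintype.mem_piFinset,
    Finset.mem_range, and_iff_right_iff_imp]
  rintro ⟨h1, h2, -⟩
  constructor
  · intro a
    rcases Nat.lt_or_ge a m with h | h
    · have := (h1 a h).1; omega
    · have := (h2 a h).1; omega
  · intro a
    rcases Nat.lt_or_ge a m with h | h
    · have := (h1 a h).2; omega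
    · have := (h2 a h).2; omega

theorem exists_eq_of_mem_kuhnSimplices {n k m : ℕ} (hm : m ≤ n) {s : (Fin n → ℕ) × (Fin n → ℕ)}
    (hs : s ∈ kuhnSimplices n k m) {j : ℕ} (hj : j < m) : ∃ a : Fin n, (a : ℕ) < m ∧ s.2 a = j := by
  rw [mem_kuhnSimplices hm] at hs
  obtain ⟨h1, -, h3⟩ := hs
  let f : Fin m → Fin m := fun a => ⟨s.2 (Fin.castLE hm a), (h1 (Fin.castLE hm a) a.2).2⟩
  have hf : Function.Injective f := by
    intro a b hab
    have := h3 _ _ a.2 b.2 (by simpa [f] using hab)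
    exact Fin.castLE_injective hm this
  obtain ⟨a, ha⟩ := (Finite.injective_iff_surjective.1 hf) ⟨j, hj⟩
  exact ⟨Fin.castLE hm a, a.2, by simpa [f] using congrArg Fin.val ha⟩

/-- A labelling of the grid `{0, …, k}ⁿ` to which the cubical Sperner lemma applies. -/
structure IsSpernerLabelling (n k : ℕ) (l : (Fin n → ℕ) → ℕ) : Prop where
  le : ∀ x, l x ≤ n
  le_of_eq_zero : ∀ x (i : Fin n), x i = 0 → l x ≤ i
  ne_of_eq : ∀ x, ∀ i : Fin n, x i = k → l x ≠ i

/-- The involution that exchanges the two Kuhn simplices sharing a facet: the pair `(s, j)` stands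
for the facet of `s` opposite to its vertex `j`. -/
def kuhnFlip {n : ℕ} (m : ℕ) (q : ((Fin n → ℕ) × (Fin n → ℕ)) × ℕ) :
    ((Fin n → ℕ) × (Fin n → ℕ)) × ℕ :=
  if q.2 = 0 then
    ((fun a => q.1.1 a + if q.1.2 a = 0 then 1 else 0,
      fun a => if (a : ℕ) ≤ m then (if q.1.2 a = 0 then m else q.1.2 a - 1) else q.1.2 a), m + 1)
  else if q.2 = m + 1 then
    ((fun a => if (a : ℕ) ≤ m ∧ q.1.2 a = m then q.1.1 a - 1 else q.1.1 a,
      fun a => if (a : ℕ) ≤ m then (if q.1.2 a = m then 0 else q.1.2 a + 1) else q.1.2 a), 0)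
  else
    ((q.1.1, fun a => if q.1.2 a = q.2 then q.2 - 1 else
      if q.1.2 a = q.2 - 1 then q.2 else q.1.2 a), q.2)

open Classical in
/-- The facets of the `(m + 1)`-dimensional Kuhn simplices carrying the labels `0, …, m`. -/
noncomputable def kuhnDoors (n k m : ℕ) (l : (Fin n → ℕ) → ℕ) :
    Finset (((Fin n → ℕ) × (Fin n → ℕ)) × ℕ) :=
  (kuhnSimplices n k (m + 1) ×ˢ Finset.range (m + 2)).filter
    fun q => ∀ a ≤ m, ∃ i ≤ m + 1, i ≠ q.2 ∧ l (kuhnVertex q.1.1 q.1.2 i) = a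

theorem card_inner_doors {n k m : ℕ} (hm : m + 1 ≤ n) {l : (Fin n → ℕ) → ℕ}
    (hl : IsSpernerLabelling n k l) :
    (((kuhnDoors n k m l).filter fun q =>
      ¬ (q.2 = m + 1 ∧ q.1.1 ⟨m, hm⟩ = 0 ∧ q.1.2 ⟨m, hm⟩ = m)).card : ZMod 2) = 0 := by
  classical
  rw [Finset.card_eq_sum_ones, Nat.cast_sum]
  have key : ∀ q ∈ (kuhnDoors n k m l).filter fun q =>
      ¬ (q.2 = m + 1 ∧ q.1.1 ⟨m, hm⟩ = 0 ∧ q.1.2 ⟨m, hm⟩ = m),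
      kuhnFlip m q ∈ ((kuhnDoors n k m l).filter fun q =>
        ¬ (q.2 = m + 1 ∧ q.1.1 ⟨m, hm⟩ = 0 ∧ q.1.2 ⟨m, hm⟩ = m)) ∧
      kuhnFlip m (kuhnFlip m q) = q ∧ kuhnFlip m q ≠ q := by
    rintro ⟨⟨y, σ⟩, j⟩ hq
    simp only [kuhnDoors, Finset.mem_filter, Finset.mem_product, Finset.mem_range] at hq
    obtain ⟨⟨⟨hs, hj⟩, hd⟩, hb⟩ := hq
    have hsurj := fun i hi => exists_eq_of_mem_kuhnSimplices hm hs (j := i) hi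
    simp only [kuhnDoors, Finset.mem_filter, Finset.mem_product, Finset.mem_range]
    rw [mem_kuhnSimplices hm] at hs ⊢
    obtain ⟨h1, h2, h3⟩ := hs
    simp only at h1 h2 h3 hsurj
    rcases Nat.eq_zero_or_pos j with rfl | hj0
    · have hy : ∀ a : Fin n, (a : ℕ) < m + 1 → σ a = 0 → y a + 1 < k := by
        intro a ha hσ
        by_contra hcon
        obtain ⟨i, hi, hi0, hli⟩ := hd a (by omega)
        refine hl.ne_of_eq _ a ?_ hli
        have := (h1 a ha).1
        simp only [kuhnVertex, hσ]
        rw [if_pos (by omega)]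
        omega
      simp only [kuhnFlip, if_true, Nat.succ_ne_zero, if_false]
      refine ⟨⟨⟨⟨⟨?_, ?_, ?_⟩, by omega⟩, ?_⟩, ?_⟩, ?_, ?_⟩
      · intro a ha
        have := h1 a ha
        have := hy a ha
        split_ifs <;> omega
      · intro a ha
        have := h2 a ha
        split_ifs <;> omega
      · intro a b ha hb hab
        apply h3 a b ha hb
        have := h1 a ha
        have := h1 b hb
        split_ifs at hab <;> omega
      · intro a ha
        obtain ⟨i, hi, hi0, hli⟩ := hd a ha
        refine ⟨i - 1, by omega, by omega, ?_⟩
        rw [← hli]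
        congr 1
        funext b
        have := h2 b
        have := h1 b
        simp only [kuhnVertex]
        split_ifs <;> omega
      · rintro ⟨-, h, h'⟩
        have := h1 ⟨m, hm⟩ (by simp)
        simp only [le_refl, if_true] at h'
        split_ifs at h h'
        omega
      · simp only [Prod.mk.injEq, and_true]
        constructor <;> funext b <;> have := h2 b <;> have := h1 b <;> split_ifs <;> omega
      · intro h
        simp at h
    · by_cases hjm : j = m + 1
      · subst hjm
        have hy : ∀ a : Fin n, (a : ℕ) < m + 1 → σ a = m → 0 < y a := by
          intro a ha hσ
          by_contra hcon
          obtain ⟨i, hi, hi0, hli⟩ := hd m le_rfl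
          have := hl.le_of_eq_zero (kuhnVertex y σ i) a (by
            simp only [kuhnVertex, hσ]
            rw [if_neg (by omega)]
            omega)
          have ham : a = ⟨m, hm⟩ := by ext; simp; omega
          subst ham
          exact hb ⟨rfl, by simpa using hcon, hσ⟩
        simp only [kuhnFlip, if_true, Nat.succ_ne_zero, if_false]
        refine ⟨⟨⟨⟨⟨?_, ?_, ?_⟩, by omega⟩, ?_⟩, ?_⟩, ?_, ?_⟩
        · intro a ha
          have := h1 a ha
          have := hy a ha
          split_ifs <;> omega
        · intro a ha
          have := h2 a ha
          split_ifs <;> omega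
        · intro a b ha hb hab
          apply h3 a b ha hb
          have := h1 a ha
          have := h1 b hb
          split_ifs at hab <;> omega
        · intro a ha
          obtain ⟨i, hi, hi0, hli⟩ := hd a ha
          refine ⟨i + 1, by omega, by omega, ?_⟩
          rw [← hli]
          congr 1
          funext b
          have := h2 b
          have := h1 b
          have := hy b
          simp only [kuhnVertex]
          split_ifs <;> omega
        · rintro ⟨h, -⟩
          omega
        · simp only [Prod.mk.injEq, and_true]
          constructor <;> funext b <;> have := h2 b <;> have := h1 b <;> have := hy b <;>
            split_ifs <;> first | omega | contradiction
        · intro h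
          simp at h
      · simp only [kuhnFlip, if_neg hj0.ne', if_neg hjm]
        refine ⟨⟨⟨⟨⟨?_, ?_, ?_⟩, by omega⟩, ?_⟩, ?_⟩, ?_, ?_⟩
        · intro a ha
          have := h1 a ha
          split_ifs <;> omega
        · intro a ha
          have := h2 a ha
          split_ifs <;> omega
        · intro a b ha hb hab
          apply h3 a b ha hb
          have := h1 a ha
          have := h1 b hb
          split_ifs at hab <;> omega
        · intro a ha
          obtain ⟨i, hi, hi0, hli⟩ := hd a ha
          refine ⟨i, by omega, by omega, ?_⟩
          rw [← hli]
          congr 1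
          funext b
          have := h2 b
          have := h1 b
          simp only [kuhnVertex]
          split_ifs <;> omega
        · rintro ⟨h, -⟩
          omega
        · simp only [Prod.mk.injEq, and_true, true_and]
          funext b
          have := h2 b
          have := h1 b
          split_ifs <;> omega
        · intro h
          obtain ⟨a, ha, haj⟩ := hsurj j (by omega)
          have := congrFun (congrArg (fun q => q.1.2) h) a
          simp only [haj, if_true] at this
          omega
  refine Finset.sum_involution (fun q _ => kuhnFlip m q) ?_ ?_ ?_ ?_
  · intro q hq
    rfl
  · intro q hq _
    exact (key q hq).2.2
  · intro q hq
    exact (key q hq).1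
  · intro q hq
    exact (key q hq).2.1

open Classical in
theorem card_outer_doors {n k m : ℕ} (hm : m + 1 ≤ n) (hk : 0 < k) (l : (Fin n → ℕ) → ℕ) :
    ((kuhnDoors n k m l).filter fun q =>
      (q.2 = m + 1 ∧ q.1.1 ⟨m, hm⟩ = 0 ∧ q.1.2 ⟨m, hm⟩ = m)).card =
    ((kuhnSimplices n k m).filter
      fun s => ∀ a ≤ m, ∃ i ≤ m, l (kuhnVertex s.1 s.2 i) = a).card := by
  refine Finset.card_nbij' (fun q => (q.1.1, fun a => if (a : ℕ) = m then n else q.1.2 a))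
    (fun s => ((s.1, fun a => if (a : ℕ) = m then m else s.2 a), m + 1)) ?_ ?_ ?_ ?_
  · rintro ⟨⟨y, σ⟩, j⟩ hq
    simp only [kuhnDoors, Finset.mem_filter, Finset.mem_product, Finset.mem_range,
      Finset.coe_filter, Set.mem_ofPred_eq] at hq ⊢
    rw [mem_kuhnSimplices (by omega)] at hq ⊢
    obtain ⟨⟨⟨⟨h1, h2, h3⟩, hj⟩, hd⟩, rfl, hy, hσ⟩ := hq
    simp only at h1 h2 h3 hd hy hσ ⊢
    refine ⟨⟨?_, ?_, ?_⟩, ?_⟩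
    · intro a ha
      have h := h1 a (by omega)
      have : σ a ≠ m := fun h' => by
        have := h3 a ⟨m, hm⟩ (by omega) (by simp) (by rw [h', hσ])
        rw [this] at ha
        simp at ha
      split_ifs <;> omega
    · intro a ha
      by_cases ham : a = ⟨m, hm⟩
      · subst ham; simp [hy]
      · have : (a : ℕ) ≠ m := fun h => ham (Fin.ext h)
        have := h2 a (by omega)
        split_ifs <;> omega
    · intro a b ha hb hab
      rw [if_neg (by omega), if_neg (by omega)] at hab
      exact h3 a b (by omega) (by omega) hab
    · intro a ha
      obtain ⟨i, hi, hij, hli⟩ := hd a ha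
      refine ⟨i, by omega, ?_⟩
      rw [← hli]
      congr 1
      funext b
      simp only [kuhnVertex]
      by_cases hbm : b = ⟨m, hm⟩
      · subst hbm
        simp only [if_true, hσ]
        rw [if_neg (by omega), if_neg (by omega)]
      · have : (b : ℕ) ≠ m := fun h => hbm (Fin.ext h)
        simp [this]
  · rintro ⟨y, σ⟩ hq
    simp only [kuhnDoors, Finset.mem_filter, Finset.mem_product, Finset.mem_range,
      Finset.coe_filter, Set.mem_ofPred_eq] at hq ⊢
    rw [mem_kuhnSimplices (by omega)] at hq ⊢
    obtain ⟨⟨h1, h2, h3⟩, hd⟩ := hq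
    simp only at h1 h2 h3 hd ⊢
    refine ⟨⟨⟨⟨?_, ?_, ?_⟩, by omega⟩, ?_⟩, trivial, (h2 _ le_rfl).1, by simp⟩
    · intro a ha
      have := h1 a
      have := h2 a
      split_ifs <;> omega
    · intro a ha
      have := h2 a (by omega)
      split_ifs <;> omega
    · intro a b ha hb hab
      have := h1 a
      have := h1 b
      have := h3 a b
      split_ifs at hab
      · exact Fin.ext (by omega)
      · omega
      · omega
      · exact h3 a b (by omega) (by omega) hab
    · intro a ha
      obtain ⟨i, hi, hli⟩ := hd a ha
      refine ⟨i, by omega, by omega, ?_⟩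
      rw [← hli]
      congr 1
      funext b
      have := h2 b
      simp only [kuhnVertex]
      split_ifs <;> omega
  · rintro ⟨⟨y, σ⟩, j⟩ hq
    simp only [Finset.coe_filter, Set.mem_ofPred_eq] at hq
    obtain ⟨-, rfl, hy, hσ⟩ := hq
    simp only [Prod.mk.injEq, and_true, true_and]
    funext b
    by_cases hbm : b = ⟨m, hm⟩
    · subst hbm; simp [hσ]
    · have : (b : ℕ) ≠ m := fun h => hbm (Fin.ext h)
      simp [this]
  · rintro ⟨y, σ⟩ hq
    simp only [Finset.coe_filter, Set.mem_ofPred_eq] at hq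
    have h2 := ((mem_kuhnSimplices (by omega) _).1 hq.1).2.1
    simp only [Prod.mk.injEq, true_and]
    funext b
    have := h2 b
    simp only at this
    split_ifs <;> omega

open Classical in
/-- Sperner's lemma for the faces of a cubical grid: an odd number of Kuhn simplices of each face
carry all labels. -/
theorem card_full_kuhnSimplices {n k : ℕ} (hk : 0 < k) {l : (Fin n → ℕ) → ℕ}
    (hl : IsSpernerLabelling n k l) (m : ℕ) (hm : m ≤ n) :
    (((kuhnSimplices n k m).filter
      fun s => ∀ a ≤ m, ∃ i ≤ m, l (kuhnVertex s.1 s.2 i) = a).card : ZMod 2) = 1 := by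
  induction m with
  | zero =>
    have h0 : l 0 = 0 := by
      rcases n with - | n
      · exact Nat.le_zero.1 (hl.le 0)
      · exact Nat.le_zero.1 (hl.le_of_eq_zero 0 0 rfl)
    have hcard : ∀ T : Finset ((Fin n → ℕ) × (Fin n → ℕ)),
        (∀ s, s ∈ T ↔ s = (0, fun _ => n)) → (T.card : ZMod 2) = 1 := by
      intro T hT
      rw [Finset.card_eq_one.2 ⟨_, Finset.ext fun s => (hT s).trans Finset.mem_singleton.symm⟩,
        Nat.cast_one]
    refine hcard _ fun ⟨y, σ⟩ => ?_
    simp only [Finset.mem_filter, mem_kuhnSimplices hm]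
    constructor
    · rintro ⟨⟨-, h, -⟩, -⟩
      simp only [Prod.mk.injEq]
      exact ⟨funext fun a => (h a (Nat.zero_le _)).1, funext fun a => (h a (Nat.zero_le _)).2⟩
    · intro h
      simp only [Prod.mk.injEq] at h
      obtain ⟨rfl, rfl⟩ := h
      refine ⟨⟨fun a ha => by omega, fun a ha => ⟨rfl, rfl⟩, fun a b ha => by omega⟩, ?_⟩
      intro a ha
      refine ⟨0, le_rfl, ?_⟩
      have : kuhnVertex (0 : Fin n → ℕ) (fun _ => n) 0 = 0 := by
        funext b; simp [kuhnVertex]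
      simp only [this, h0]; omega
  | succ m ih =>
    rw [← ih (by omega), ← card_outer_doors hm hk l]
    have h1 : ((kuhnDoors n k m l).card : ZMod 2) =
        (((kuhnSimplices n k (m + 1)).filter fun s =>
          ∀ a ≤ m + 1, ∃ i ≤ m + 1, l (kuhnVertex s.1 s.2 i) = a).card : ZMod 2) := by
      rw [kuhnDoors, Finset.card_filter, Finset.sum_product, Nat.cast_sum, Finset.card_filter,
        Nat.cast_sum]
      refine Finset.sum_congr rfl fun s hs => ?_
      rw [← Finset.card_filter, card_doors_mod_two m (fun i => l (kuhnVertex s.1 s.2 i))]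
      · push_cast; rfl
      · intro i hi
        rcases Nat.lt_or_ge (m + 1) n with h | h
        · refine hl.le_of_eq_zero _ ⟨m + 1, h⟩ ?_
          have := ((mem_kuhnSimplices hm s).1 hs).2.1 ⟨m + 1, h⟩ le_rfl
          simp only [kuhnVertex]
          rw [if_neg (by omega)]
          omega
        · have := hl.le (kuhnVertex s.1 s.2 i)
          omega
    rw [← h1, ← Finset.card_filter_add_card_filter_not (s := kuhnDoors n k m l) (fun q =>
      (q.2 = m + 1 ∧ q.1.1 ⟨m, hm⟩ = 0 ∧ q.1.2 ⟨m, hm⟩ = m)), Nat.cast_add,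
      card_inner_doors hm hl, add_zero]

/-- The cubical Sperner lemma: some cell of the grid carries all labels. -/
theorem exists_full_cell {n k : ℕ} (hk : 0 < k) {l : (Fin n → ℕ) → ℕ}
    (hl : IsSpernerLabelling n k l) :
    ∃ y : Fin n → ℕ, (∀ a, y a < k) ∧ ∀ c ≤ n, ∃ x : Fin n → ℕ,
      (∀ a, y a ≤ x a ∧ x a ≤ y a + 1) ∧ l x = c := by
  classical
  have h := card_full_kuhnSimplices hk hl n le_rfl
  have : ((kuhnSimplices n k n).filter
      fun s => ∀ a ≤ n, ∃ i ≤ n, l (kuhnVertex s.1 s.2 i) = a).Nonempty := by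
    rw [Finset.nonempty_iff_ne_empty]
    intro h0
    rw [h0] at h
    simp at h
  obtain ⟨s, hs⟩ := this
  rw [Finset.mem_filter, mem_kuhnSimplices le_rfl] at hs
  refine ⟨s.1, fun a => (hs.1.1 a a.2).1, fun c hc => ?_⟩
  obtain ⟨i, -, hi⟩ := hs.2 c hc
  refine ⟨_, fun a => ?_, hi⟩
  simp only [kuhnVertex]
  split_ifs <;> omega

theorem exists_mem_of_open_cover_cube_fin {n : ℕ} {κ : Type*} (U : κ → Set (Fin n → ℝ))
    (hU : ∀ c, IsOpen (U c)) (hcov : Set.Icc 0 1 ⊆ ⋃ c, U c)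
    (hface : ∀ c (i : Fin n), ∀ x ∈ U c ∩ Set.Icc 0 1, ∀ x' ∈ U c ∩ Set.Icc 0 1,
      x i = 0 → x' i ≠ 1) :
    ∃ x ∈ Set.Icc (0 : Fin n → ℝ) 1, ∃ t : Finset κ, t.card = n + 1 ∧ ∀ c ∈ t, x ∈ U c := by
  classical
  obtain ⟨δ, hδ, hball⟩ := lebesgue_number_lemma_of_metric isCompact_Icc hU hcov
  obtain ⟨k', hk'⟩ := exists_nat_one_div_lt hδ
  set k := k' + 1 with hk
  have hk0 : (0 : ℝ) < k := by positivity
  let pt : (Fin n → ℕ) → Fin n → ℝ := fun x a => min ((x a : ℝ) / k) 1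
  have hpt : ∀ x, pt x ∈ Set.Icc (0 : Fin n → ℝ) 1 := fun x =>
    ⟨fun a => le_min (by positivity) zero_le_one, fun a => min_le_right _ _⟩
  choose col hcol using fun x => hball (pt x) (hpt x)
  have hmem : ∀ x, pt x ∈ U (col x) ∩ Set.Icc 0 1 := fun x =>
    ⟨hcol x (Metric.mem_ball_self hδ), hpt x⟩
  let Q : κ → ℕ → Prop := fun c i => i = n ∨ ∃ hi : i < n, ∃ x ∈ U c ∩ Set.Icc 0 1, x ⟨i, hi⟩ = 0
  have hQ : ∀ c, ∃ i, Q c i := fun c => ⟨n, Or.inl rfl⟩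
  let lab : κ → ℕ := fun c => Nat.find (hQ c)
  have hl : IsSpernerLabelling n k fun x => lab (col x) := by
    refine ⟨fun x => Nat.find_min' _ (Or.inl rfl), fun x i hx => ?_, fun x i hx h => ?_⟩
    · exact Nat.find_min' _ (Or.inr ⟨i.2, pt x, hmem x, by simp [pt, hx]⟩)
    · have hs : Q (col x) (lab (col x)) := Nat.find_spec (hQ (col x))
      rw [h] at hs
      rcases hs with hs | ⟨hi, z, hz, hz0⟩
      · exact i.2.ne hs
      · exact hface _ i z hz _ (hmem x) hz0 (by simp [pt, hx])
  obtain ⟨y, -, hy⟩ := exists_full_cell (Nat.succ_pos k') hl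
  choose! x hx hlx using hy
  refine ⟨pt y, hpt y, (Finset.range (n + 1)).image fun c => col (x c), ?_, ?_⟩
  · rw [Finset.card_image_of_injOn, Finset.card_range]
    intro c hc c' hc' h
    have hc : c ≤ n := by simpa [Nat.lt_succ_iff] using hc
    have hc' : c' ≤ n := by simpa [Nat.lt_succ_iff] using hc'
    rw [← hlx c hc, ← hlx c' hc']
    exact congrArg lab h
  · intro c hc
    obtain ⟨i, hi, rfl⟩ := Finset.mem_image.1 hc
    have hi : i ≤ n := by simpa [Nat.lt_succ_iff] using hi
    refine hcol (x i) (lt_of_le_of_lt ?_ (by simpa using hk') : dist (pt y) (pt (x i)) < δ)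
    refine (dist_pi_le_iff (by positivity)).2 fun a => ?_
    rw [Real.dist_eq]
    refine (abs_min_sub_min_le_max _ _ _ _).trans ?_
    have h1 : (y a : ℝ) ≤ x i a := by exact_mod_cast (hx i hi a).1
    have h2 : (x i a : ℝ) ≤ y a + 1 := by exact_mod_cast (hx i hi a).2
    simp only [sub_self, abs_zero, ← sub_div, abs_div, abs_of_pos hk0]
    refine max_le ?_ (by positivity)
    have hkk : ((k' : ℝ) + 1) = k := by simp [hk]
    rw [abs_of_nonpos (by linarith), ← one_div, hkk]
    gcongr
    linarith

/-- Lebesgue's covering theorem: if no member of an open cover of a cube meets two opposite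
faces, then some point of the cube lies in more members than the dimension. -/
theorem exists_mem_of_open_cover_cube {ι κ : Type*} [Fintype ι] (U : κ → Set (ι → ℝ))
    (hU : ∀ c, IsOpen (U c)) (hcov : Set.Icc 0 1 ⊆ ⋃ c, U c)
    (hface : ∀ c (i : ι), ∀ x ∈ U c ∩ Set.Icc 0 1, ∀ x' ∈ U c ∩ Set.Icc 0 1,
      x i = 0 → x' i ≠ 1) :
    ∃ x ∈ Set.Icc (0 : ι → ℝ) 1, ∃ t : Finset κ,
      t.card = Fintype.card ι + 1 ∧ ∀ c ∈ t, x ∈ U c := by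
  let e := Fintype.equivFin ι
  have hIcc : ∀ x : Fin (Fintype.card ι) → ℝ, x ∈ Set.Icc (0 : Fin _ → ℝ) 1 →
      x ∘ e ∈ Set.Icc (0 : ι → ℝ) 1 := fun x hx => ⟨fun a => hx.1 (e a), fun a => hx.2 (e a)⟩
  obtain ⟨x, hx, t, ht, hxt⟩ := exists_mem_of_open_cover_cube_fin
    (fun c => (fun x : Fin (Fintype.card ι) → ℝ => x ∘ e) ⁻¹' U c)
    (fun c => (hU c).preimage (by fun_prop))
    (fun x hx => by
      obtain ⟨c, hc⟩ := Set.mem_iUnion.1 (hcov (hIcc x hx))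
      exact Set.mem_iUnion.2 ⟨c, hc⟩)
    (fun c i x hx x' hx' h => by
      have := hface c (e.symm i) (x ∘ e) ⟨hx.1, hIcc x hx.2⟩ (x' ∘ e) ⟨hx'.1, hIcc x' hx'.2⟩
      simpa [h] using this)
  exact ⟨x ∘ e, hIcc x hx, t, ht, hxt⟩

end Sperner

section Covering

theorem continuous_abs_sub_round : Continuous fun r : ℝ => |r - round r| := by
  have : (fun r : ℝ => |r - round r|) = fun r : ℝ => ‖(r : UnitAddCircle)‖ := by
    funext r; rw [UnitAddCircle.norm_eq]
  rw [this]
  exact (AddCircle.continuous_mk' 1).norm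

theorem abs_sub_round_eq_zero {r : ℝ} : |r - round r| = 0 ↔ ∃ z : ℤ, r = z := by
  rw [abs_eq_zero, sub_eq_zero]
  constructor
  · exact fun h => ⟨_, h⟩
  · rintro ⟨z, rfl⟩; simp

open Classical in
theorem IsCompact.exists_pos_forall_card_le {Y : Type*} [TopologicalSpace Y] {ι : Type*}
    [Fintype ι] {X : Set Y} (hX : IsCompact X) (d : ι → Y → ℝ) (hd : ∀ i, Continuous (d i))
    (hd0 : ∀ i y, 0 ≤ d i y) (k : ℕ)
    (hk : ∀ x ∈ X, (Finset.univ.filter fun i => d i x = 0).card ≤ k) :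
    ∃ δ > 0, ∀ x ∈ X, (Finset.univ.filter fun i => d i x ≤ δ).card ≤ k := by
  let V : ℕ → Set Y := fun n => ⋃ A : {A : Finset ι // A.card ≤ k},
    {y | ∀ i ∉ A.1, 1 / ((n : ℝ) + 1) < d i y}
  have hV : ∀ n, IsOpen (V n) := fun n => by
    refine isOpen_iUnion fun A => ?_
    have : {y | ∀ i ∉ A.1, 1 / ((n : ℝ) + 1) < d i y} =
        ⋂ i : {i // i ∉ A.1}, {y | 1 / ((n : ℝ) + 1) < d i y} := by
      ext y; simp
    rw [this]
    exact isOpen_iInter_of_finite fun i => isOpen_lt continuous_const (hd i)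
  have hmono : Monotone V := by
    intro m n hmn
    refine Set.iUnion_mono fun A y hy i hi => ?_
    refine lt_of_le_of_lt ?_ (hy i hi)
    gcongr
  have hcov : X ⊆ ⋃ n, V n := by
    intro x hx
    let A := Finset.univ.filter fun i => d i x = 0
    have hpos : ∀ i ∉ A, 0 < d i x := fun i hi =>
      lt_of_le_of_ne (hd0 i x) fun h => hi (by simp [A, h.symm])
    have : ∀ᶠ n : ℕ in Filter.atTop, ∀ i : {i // i ∉ A}, 1 / ((n : ℝ) + 1) < d i x := by
      rw [Filter.eventually_all]
      exact fun i => tendsto_one_div_add_atTop_nhds_zero_nat.eventually_lt_const (hpos i i.2)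
    obtain ⟨n, hn⟩ := this.exists
    exact Set.mem_iUnion.2 ⟨n, Set.mem_iUnion.2 ⟨⟨A, hk x hx⟩, fun i hi => hn ⟨i, hi⟩⟩⟩
  obtain ⟨n, hn⟩ := hX.elim_directed_cover V hV hcov hmono.directed_le
  refine ⟨1 / ((n : ℝ) + 1), by positivity, fun x hx => ?_⟩
  obtain ⟨A, hA⟩ := Set.mem_iUnion.1 (hn hx)
  refine (Finset.card_le_card fun i hi => ?_).trans A.2
  by_contra hiA
  exact absurd (hA i hiA) (not_lt.2 (Finset.mem_filter.1 hi).2)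

open Classical in
theorem exists_openCover_ordOn_le_of_ranked {Y Q : Type*} [TopologicalSpace Y] {X : Set Y}
    (hX : IsCompact X) (piece : Q → Set Y) (hpiece : ∀ q, IsOpen (piece q))
    (hcov : X ⊆ ⋃ q, piece q) (r : Q → ℕ) (k : ℕ) (hr : ∀ q, r q ≤ k)
    (hdisj : ∀ q q' y, r q = r q' → y ∈ piece q → y ∈ piece q' → q = q') :
    ∃ β : Finset (Set Y), IsOpenCoverOf X β ∧ ordOn X β ≤ k ∧
      ∀ U ∈ β, (U ∩ X).Nonempty ∧ ∃ q, U = piece q := by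
  obtain ⟨T, hT⟩ := hX.elim_finite_subcover piece hpiece hcov
  refine ⟨(T.image piece).filter fun U => (U ∩ X).Nonempty, ⟨?_, ?_⟩, ?_, ?_⟩
  · intro U hU
    obtain ⟨q, -, rfl⟩ := Finset.mem_image.1 (Finset.mem_filter.1 hU).1
    exact hpiece q
  · intro x hx
    obtain ⟨q, hq, hxq⟩ := Set.mem_iUnion₂.1 (hT hx)
    exact Set.mem_iUnion₂.2 ⟨piece q, Finset.mem_filter.2
      ⟨Finset.mem_image_of_mem piece hq, x, hxq, hx⟩, hxq⟩
  · refine ciSup_le' fun y => ?_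
    have hsub : {U : Set Y | U ∈ (T.image piece).filter
        (fun U => (U ∩ X).Nonempty) ∧ (y : Y) ∈ U} ⊆
        ((T.filter fun q => (y : Y) ∈ piece q).image piece : Finset (Set Y)) := by
      rintro U ⟨hU, hyU⟩
      obtain ⟨q, hq, rfl⟩ := Finset.mem_image.1 (Finset.mem_filter.1 hU).1
      exact Finset.mem_coe.2 (Finset.mem_image.2 ⟨q, Finset.mem_filter.2 ⟨hq, hyU⟩, rfl⟩)
    have h1 := Set.ncard_le_ncard hsub (Finset.finite_toSet _)
    rw [Set.ncard_coe_finset] at h1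
    have h2 : (T.filter fun q => (y : Y) ∈ piece q).card ≤ (Finset.range (k + 1)).card := by
      refine Finset.card_le_card_of_injOn r ?_ ?_
      · intro q _
        simp only [Finset.coe_range, Set.mem_Iio]
        exact Nat.lt_succ_of_le (hr q)
      · intro q hq q' hq' h
        exact hdisj q q' y h (Finset.mem_filter.1 hq).2 (Finset.mem_filter.1 hq').2
    have h3 := Finset.card_image_le (s := T.filter fun q => (y : Y) ∈ piece q)
      (f := piece)
    rw [Finset.card_range] at h2
    omega
  · intro U hU
    refine ⟨(Finset.mem_filter.1 hU).2, ?_⟩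
    obtain ⟨q, -, rfl⟩ := Finset.mem_image.1 (Finset.mem_filter.1 hU).1
    exact ⟨q, rfl⟩

open Classical in
/-- A compact set on which at most `k` of the functions `f i` are simultaneously integral has a
finite open cover of order at most `k` by sets on which every `f i` varies by less than `1`. -/
theorem exists_openCover_ordOn_le {Y : Type*} [TopologicalSpace Y] {ι : Type*} [Fintype ι]
    {X : Set Y} (hX : IsCompact X) (f : ι → Y → ℝ) (hf : ∀ i, Continuous (f i)) (k : ℕ)
    (hk : ∀ x ∈ X, (Finset.univ.filter fun i => ∃ z : ℤ, f i x = z).card ≤ k) :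
    ∃ β : Finset (Set Y), IsOpenCoverOf X β ∧ ordOn X β ≤ k ∧
      ∀ U ∈ β, (U ∩ X).Nonempty ∧ ∀ y ∈ U, ∀ y' ∈ U, ∀ i, |f i y - f i y'| < 1 := by
  obtain ⟨δ₀, hδ₀, hcard₀⟩ := hX.exists_pos_forall_card_le (fun i y => |f i y - round (f i y)|)
    (fun i => continuous_abs_sub_round.comp (hf i)) (fun i y => abs_nonneg _) k
    (by simpa only [abs_sub_round_eq_zero] using hk)
  set δ := min δ₀ (1 / 4) with hδ
  have hδ0 : 0 < δ := lt_min hδ₀ (by norm_num)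
  have hδ1 : δ ≤ 1 / 4 := min_le_right _ _
  let a : ℕ → ℝ := fun t => δ * ((t + 1) / (k + 1))
  have ha0 : ∀ t, 0 < a t := fun t => by positivity
  have hak : a k ≤ δ := by simp only [a]; rw [div_self (by positivity), mul_one]
  have hamono : StrictMono a := by
    intro s t hst
    have : (s : ℝ) < t := by exact_mod_cast hst
    simp only [a]
    gcongr
  have ha1 : ∀ t ≤ k, a t ≤ 1 / 4 := fun t ht => (hamono.monotone ht).trans (hak.trans hδ1)
  let piece : (Finset ι × (ι → ℤ)) → Set Y := fun q => {y | ∀ i,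
    (i ∈ q.1 → |f i y - q.2 i| < a q.1.card) ∧
    (i ∉ q.1 → q.2 i + a q.1.card < f i y ∧ f i y < q.2 i + 1 - a q.1.card)}
  have hpiece : ∀ q, IsOpen (piece q) := by
    intro q
    simp only [piece, Set.ofPred_forall]
    refine isOpen_iInter_of_finite fun i => ?_
    have hfi := hf i
    by_cases hi : i ∈ q.1
    · simp only [hi, true_implies, not_true, false_implies, and_true]
      exact isOpen_lt (by fun_prop) continuous_const
    · simp only [hi, not_false_eq_true, true_implies, false_implies, true_and]
      exact (isOpen_lt continuous_const hfi).inter (isOpen_lt hfi continuous_const)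
  have hdisj : ∀ q q' : Finset ι × (ι → ℤ), ∀ y, q.1.card ≤ k → q.1.card = q'.1.card →
      y ∈ piece q → y ∈ piece q' → q = q' := by
    rintro ⟨A, z⟩ ⟨A', z'⟩ y hAk hcard hy hy'
    simp only at hAk hcard
    simp only [piece, Set.mem_ofPred_eq, ← hcard] at hy hy'
    have h1 := ha1 _ hAk
    have key : ∀ (z z' : ℤ) (r : ℝ), |r - z| < a A.card →
        ¬ (z' + a A.card < r ∧ r < z' + 1 - a A.card) := by
      rintro z z' r hr ⟨h2, h3⟩
      rw [abs_lt] at hr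
      have h4 : (z' : ℝ) < z := by linarith
      have h5 : (z : ℝ) < z' + 1 := by linarith
      have h4' : z' < z := by exact_mod_cast h4
      have h5' : z < z' + 1 := by exact_mod_cast h5
      omega
    have hsub : A ⊆ A' := by
      intro i hi
      by_contra hi'
      exact key _ _ _ ((hy i).1 hi) ((hy' i).2 hi')
    have hAA : A = A' := Finset.eq_of_subset_of_card_le hsub hcard.ge
    subst hAA
    simp only [Prod.mk.injEq, true_and]
    funext i
    have heq : ∀ z z' : ℤ, (z : ℝ) < z' + 1 → (z' : ℝ) < z + 1 → z = z' := by
      intro z z' h h'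
      have h2 : z < z' + 1 := by exact_mod_cast h
      have h3 : z' < z + 1 := by exact_mod_cast h'
      omega
    by_cases hi : i ∈ A
    · have h2 := abs_lt.1 ((hy i).1 hi)
      have h3 := abs_lt.1 ((hy' i).1 hi)
      exact heq _ _ (by linarith) (by linarith)
    · have h2 := (hy i).2 hi
      have h3 := (hy' i).2 hi
      have := ha0 A.card
      exact heq _ _ (by linarith) (by linarith)
  have hcov : X ⊆ ⋃ q : {q : Finset ι × (ι → ℤ) // q.1.card ≤ k}, piece q.1 := by
    intro x hx
    let c : ℕ → ℕ := fun t => (Finset.univ.filter fun i => |f i x - round (f i x)| ≤ a t).card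
    have hck : c k ≤ k := by
      refine (Finset.card_le_card ?_).trans (hcard₀ x hx)
      intro i hi
      rw [Finset.mem_filter] at hi ⊢
      exact ⟨hi.1, hi.2.trans (hak.trans (min_le_left _ _))⟩
    have hex : ∃ t, c t ≤ t := ⟨k, hck⟩
    obtain ⟨t, htdef⟩ : ∃ t, t = Nat.find hex := ⟨_, rfl⟩
    have hct : c t ≤ t := htdef ▸ Nat.find_spec hex
    have htk : t ≤ k := htdef ▸ Nat.find_min' hex hck
    let A := Finset.univ.filter fun i => |f i x - round (f i x)| < a t
    have hAsub : A ⊆ Finset.univ.filter fun i => |f i x - round (f i x)| ≤ a t := by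
      intro i hi
      rw [Finset.mem_filter] at hi ⊢
      exact ⟨hi.1, hi.2.le⟩
    have hAt : t ≤ A.card := by
      rcases t with - | t
      · exact Nat.zero_le _
      · have h1 : ¬ c t ≤ t := Nat.find_min hex (by omega)
        have h2 : c t ≤ A.card := by
          refine Finset.card_le_card fun i hi => ?_
          rw [Finset.mem_filter] at hi ⊢
          exact ⟨hi.1, hi.2.trans_lt (hamono (Nat.lt_succ_self t))⟩
        omega
    have hAeq := Finset.eq_of_subset_of_card_le hAsub (hct.trans hAt)
    have hAcard : A.card = t := le_antisymm ((Finset.card_le_card hAsub).trans hct) hAt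
    refine Set.mem_iUnion.2 ⟨⟨(A, fun i => if i ∈ A then round (f i x) else ⌊f i x⌋),
      hAcard.trans_le htk⟩, fun i => ⟨fun hi => ?_, fun hi => ?_⟩⟩
    · simp only at hi ⊢
      rw [if_pos hi, hAcard]
      exact (Finset.mem_filter.1 hi).2
    · simp only at hi ⊢
      rw [if_neg hi, hAcard]
      have h1 : a t < |f i x - round (f i x)| := by
        by_contra hcon
        rw [hAeq] at hi
        exact hi (Finset.mem_filter.2 ⟨Finset.mem_univ _, not_lt.1 hcon⟩)
      have h2 := round_le (f i x) ⌊f i x⌋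
      have h3 := round_le (f i x) (⌊f i x⌋ + 1)
      push_cast at h3
      have e2 : |f i x - ⌊f i x⌋| = f i x - ⌊f i x⌋ :=
        abs_of_nonneg (by linarith [Int.floor_le (f i x)])
      have e3 : |f i x - (⌊f i x⌋ + 1)| = -(f i x - (⌊f i x⌋ + 1)) :=
        abs_of_nonpos (by linarith [Int.lt_floor_add_one (f i x)])
      rw [e2] at h2
      rw [e3] at h3
      constructor <;> linarith
  obtain ⟨β, h1, h2, h3⟩ := exists_openCover_ordOn_le_of_ranked hX
    (fun q : {q : Finset ι × (ι → ℤ) // q.1.card ≤ k} => piece q.1) (fun q => hpiece q.1) hcov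
    (fun q => q.1.1.card) k (fun q => q.2)
    (fun q q' y h hy hy' => Subtype.ext (hdisj q.1 q'.1 y q.2 h hy hy'))
  refine ⟨β, h1, h2, fun U hU => ⟨(h3 U hU).1, ?_⟩⟩
  obtain ⟨q, rfl⟩ := (h3 U hU).2
  intro y hy y' hy' i
  have h1 := ha1 _ q.2
  have h0 := ha0 q.1.1.card
  by_cases hi : i ∈ q.1.1
  · have h2 := abs_lt.1 ((hy i).1 hi)
    have h3 := abs_lt.1 ((hy' i).1 hi)
    rw [abs_lt]; constructor <;> linarith
  · have h2 := (hy i).2 hi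
    have h3 := (hy' i).2 hi
    rw [abs_lt]; constructor <;> linarith

end Covering

section Generic

theorem exists_forall_sum_mul_ne {N : ℕ} {I : Type*} [Countable I] (a : I → Fin N → ℝ)
    (c : I → ℝ) : ∃ θ : Fin N → ℝ, ∀ i, a i ≠ 0 → ∑ j, a i j * θ j ≠ c i := by
  let p : I → Polynomial ℝ := fun i =>
    ∑ j, Polynomial.C (a i j) * Polynomial.X ^ ((j : ℕ) + 1) - Polynomial.C (c i)
  have hp : ∀ i, a i ≠ 0 → p i ≠ 0 := by
    intro i hi h0
    refine hi (funext fun j => ?_)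
    have := congrArg (fun q => Polynomial.coeff q ((j : ℕ) + 1)) h0
    simpa [p, Polynomial.finsetSum_coeff, Polynomial.coeff_C_mul, Polynomial.coeff_X_pow,
      Polynomial.coeff_C, Fin.val_inj] using this
  have hc : (⋃ i, {t | a i ≠ 0 ∧ (p i).IsRoot t}).Countable := by
    refine Set.countable_iUnion fun i => ?_
    by_cases hi : a i = 0
    · simp [hi]
    · exact ((Polynomial.finite_setOfPred_isRoot (hp i hi)).subset fun t ht => ht.2).countable
  obtain ⟨t, ht⟩ : (⋃ i, {t | a i ≠ 0 ∧ (p i).IsRoot t})ᶜ.Nonempty := by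
    by_contra h
    rw [Set.not_nonempty_iff_eq_empty, Set.compl_empty_iff] at h
    exact Cardinal.not_countable_real (h ▸ hc)
  refine ⟨fun j => t ^ ((j : ℕ) + 1), fun i hi h => ht (Set.mem_iUnion.2 ⟨i, hi, ?_⟩)⟩
  simp [p, Polynomial.IsRoot, Polynomial.eval_finsetSum, h]

/-- If `A` has more elements than `dim V`, some nontrivial linear relation between the coordinates
in `A` holds on `V`. -/
theorem exists_coord_relation {N : ℕ} (V : Submodule ℝ (EuclideanSpace ℝ (Fin N)))
    (A : Finset (Fin N)) (hA : Module.finrank ℝ V < A.card) :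
    ∃ a : Fin N → ℝ, a ≠ 0 ∧ (∀ j ∉ A, a j = 0) ∧ ∀ v ∈ V, ∑ j, a j * v j = 0 := by
  classical
  let f : (A → ℝ) →ₗ[ℝ] Module.Dual ℝ V :=
    { toFun := fun a =>
        { toFun := fun v => ∑ j : A, a j * (v : EuclideanSpace ℝ (Fin N)) j
          map_add' := fun v w => by simp [mul_add, Finset.sum_add_distrib]
          map_smul' := fun r v => by simp [Finset.mul_sum, mul_left_comm] }
      map_add' := fun a b => by ext v; simp [add_mul, Finset.sum_add_distrib]
      map_smul' := fun r a => by ext v; simp [Finset.mul_sum, mul_assoc] }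
  have hker : LinearMap.ker f ≠ ⊥ := by
    apply LinearMap.ker_ne_bot_of_finrank_lt
    rw [Subspace.dual_finrank_eq]
    simpa using hA
  obtain ⟨a, ha, ha0⟩ := Submodule.exists_mem_ne_zero_of_ne_bot hker
  refine ⟨fun j => if h : j ∈ A then a ⟨j, h⟩ else 0, ?_, fun j hj => dif_neg hj, ?_⟩
  · intro h
    refine ha0 (funext fun j => ?_)
    simpa using congrFun h j
  · intro v hv
    have h1 : ∑ j : A, a j * v j = 0 := by
      have := LinearMap.congr_fun (LinearMap.mem_ker.1 ha) ⟨v, hv⟩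
      simpa [f] using this
    refine Eq.trans ?_ h1
    rw [← Finset.sum_subset (Finset.subset_univ A) (fun j _ hj => by simp [hj]),
      ← Finset.sum_coe_sort A]
    simp

open Classical in
/-- A generic translate of the grid of mesh `η` meets each simplex of a finite family in general
position. -/
theorem exists_generic_offset {N : ℕ} (S : Finset (Finset (EuclideanSpace ℝ (Fin N)))) {η : ℝ}
    (hη : η ≠ 0) : ∃ θ : Fin N → ℝ, ∀ s ∈ S, ∀ x ∈ convexHull ℝ (s : Set (EuclideanSpace ℝ (Fin N))),
      (Finset.univ.filter fun j => ∃ z : ℤ, (x j - θ j) / η = z).card ≤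
        Module.finrank ℝ (vectorSpan ℝ (s : Set (EuclideanSpace ℝ (Fin N)))) := by
  have hrel : ∀ (s : Finset (EuclideanSpace ℝ (Fin N))) (A : Finset (Fin N)),
      ∃ a : Fin N → ℝ, Module.finrank ℝ (vectorSpan ℝ (s : Set (EuclideanSpace ℝ (Fin N)))) < A.card →
        a ≠ 0 ∧ (∀ j ∉ A, a j = 0) ∧ ∀ v ∈ vectorSpan ℝ (s : Set (EuclideanSpace ℝ (Fin N))),
          ∑ j, a j * v j = 0 := by
    intro s A
    by_cases h : Module.finrank ℝ (vectorSpan ℝ (s : Set (EuclideanSpace ℝ (Fin N)))) < A.card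
    · obtain ⟨a, ha⟩ := exists_coord_relation _ A h
      exact ⟨a, fun _ => ha⟩
    · exact ⟨0, fun h' => absurd h' h⟩
  choose a ha using hrel
  obtain ⟨θ, hθ⟩ := exists_forall_sum_mul_ne
    (I := (Σ s : S, s.1) × Finset (Fin N) × (Fin N → ℤ)) (fun q => a q.1.1.1 q.2.1)
    (fun q => ∑ j, a q.1.1.1 q.2.1 j * (q.1.2.1 j - η * q.2.2 j))
  refine ⟨θ, fun s hs x hx => ?_⟩
  by_contra hcon
  set A := Finset.univ.filter fun j => ∃ z : ℤ, (x j - θ j) / η = z with hAdef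
  obtain ⟨ha0, haA, hav⟩ := ha s A (not_le.1 hcon)
  have hne : (s : Set (EuclideanSpace ℝ (Fin N))).Nonempty := convexHull_nonempty_iff.1 ⟨x, hx⟩
  obtain ⟨x₀, hx₀⟩ := hne
  have hz : ∀ j, ∃ z : ℤ, j ∈ A → (x j - θ j) / η = z := by
    intro j
    by_cases h : j ∈ A
    · obtain ⟨z, hz⟩ := (Finset.mem_filter.1 h).2
      exact ⟨z, fun _ => hz⟩
    · exact ⟨0, fun h' => absurd h' h⟩
  choose z hz using hz
  refine hθ ⟨⟨⟨s, hs⟩, ⟨x₀, hx₀⟩⟩, A, z⟩ ha0 ?_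
  have hmem : x - x₀ ∈ vectorSpan ℝ (s : Set (EuclideanSpace ℝ (Fin N))) := by
    rw [← direction_affineSpan, ← vsub_eq_sub]
    exact AffineSubspace.vsub_mem_direction (convexHull_subset_affineSpan _ hx)
      (subset_affineSpan ℝ _ hx₀)
  have h1 := hav _ hmem
  have h2 : ∀ j, a s A j * θ j = a s A j * (x j - η * z j) := by
    intro j
    by_cases hj : j ∈ A
    · rw [← hz j hj]; field_simp; ring
    · rw [haA j hj]; simp
  simp only [h2]
  have h3 : ∑ j, a s A j * (x j - x₀ j) = 0 := by simpa using h1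
  rw [← sub_eq_zero, ← Finset.sum_sub_distrib, ← h3]
  exact Finset.sum_congr rfl fun j _ => by ring

end Generic

section Visits

variable {G : Type*} [Group G]

open Classical in
/-- The number of `k ∈ K` with `k * c ∈ J`. -/
noncomputable def visits (J : Set G) (K : Finset G) (c : G) : ℕ :=
  (K.filter fun k => k * c ∈ J).card

/-- `J` has upper Banach density less than `r`. -/
def Thin (J : Set G) (r : ℝ) : Prop :=
  ∃ K : Finset G, K.Nonempty ∧ ∀ c, (visits J K c : ℝ) < r * K.card

open Classical in
/-- The number of points of `F` moved out of `F` by left translation by `g`. -/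
noncomputable def escape (g : G) (F : Finset G) : ℕ := (F.filter fun f => g * f ∉ F).card

open Classical in
theorem visits_le_card (J : Set G) (K : Finset G) (c : G) : visits J K c ≤ K.card :=
  Finset.card_filter_le _ _

open Classical in
theorem visits_congr {J J' : Set G} {K : Finset G} {c c' : G}
    (h : ∀ k ∈ K, k * c ∈ J ↔ k * c' ∈ J') : visits J K c = visits J' K c' :=
  congrArg Finset.card (Finset.filter_congr h)

theorem visits_le_card_of_injective {J : Set G} {K L : Finset G} {c : G} {f : G → G}
    (hf : Function.Injective f) (h : ∀ k ∈ K, k * c ∈ J → f k ∈ L) : visits J K c ≤ L.card := by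
  classical
  refine Finset.card_le_card_of_injOn f (fun k hk => ?_) hf.injOn
  obtain ⟨hk, hkJ⟩ := Finset.mem_filter.1 (Finset.mem_coe.1 hk)
  exact h k hk hkJ

open Classical in
theorem visits_mono {J J' : Set G} (h : J ⊆ J') (K : Finset G) (c : G) :
    visits J K c ≤ visits J' K c :=
  Finset.card_le_card (Finset.monotone_filter_right K fun _ _ hk => h hk)

theorem visits_union_le (J J' : Set G) (K : Finset G) (c : G) :
    visits (J ∪ J') K c ≤ visits J K c + visits J' K c := by
  classical
  unfold visits
  refine le_trans (Finset.card_le_card ?_) (Finset.card_union_le _ _)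
  intro k
  simp only [Finset.mem_filter, Finset.mem_union, Set.mem_union]
  tauto

theorem escape_le_ncard_symmDiff (g : G) (F : Finset G) :
    escape g F ≤ (symmDiff (g • (F : Set G)) (F : Set G)).ncard := by
  classical
  have hfin : (symmDiff (g • (F : Set G)) (F : Set G)).Finite :=
    ((F.finite_toSet.smul_set).union F.finite_toSet).subset
      (by rw [Set.symmDiff_def]; exact Set.union_subset_union Set.sdiff_subset Set.sdiff_subset)
  have h : (fun f => g * f) '' (F.filter fun f => g * f ∉ F : Finset G) ⊆
      symmDiff (g • (F : Set G)) (F : Set G) := by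
    rintro _ ⟨f, hf, rfl⟩
    obtain ⟨hf, hgf⟩ := Finset.mem_filter.1 (Finset.mem_coe.1 hf)
    exact Or.inl ⟨Set.smul_mem_smul_set hf, hgf⟩
  have h2 := Set.ncard_le_ncard h hfin
  rw [Set.ncard_image_of_injective _ (mul_right_injective g), Set.ncard_coe_finset] at h2
  exact h2

theorem IsFolnerSeq.tendsto_escape {Fo : ℕ → Finset G} (hFo : IsFolnerSeq G Fo) (g : G) :
    Filter.Tendsto (fun n => (escape g (Fo n) : ℝ) / (Fo n).card) Filter.atTop (nhds 0) := by
  refine squeeze_zero (fun n => by positivity) (fun n => ?_) (hFo.2 g)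
  gcongr
  exact escape_le_ncard_symmDiff g (Fo n)

theorem IsFolnerSeq.eventually_sum_escape_le {Fo : ℕ → Finset G} (hFo : IsFolnerSeq G Fo)
    (M : Finset G) {η : ℝ} (hη : 0 < η) :
    ∀ᶠ n in Filter.atTop, ∑ m ∈ M, (escape m (Fo n) : ℝ) ≤ η * (Fo n).card := by
  have h : Filter.Tendsto (fun n => ∑ m ∈ M, (escape m (Fo n) : ℝ) / (Fo n).card) Filter.atTop
      (nhds 0) := by
    simpa using tendsto_finsetSum M fun m _ => hFo.tendsto_escape m
  filter_upwards [h.eventually_lt_const hη] with n hn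
  have hpos : (0 : ℝ) < (Fo n).card := by exact_mod_cast (hFo.1 n).card_pos
  rw [← Finset.sum_div, div_lt_iff₀ hpos] at hn
  exact hn.le

open Classical in
theorem visits_le_escape_add (J : Set G) (F : Finset G) (c m : G) :
    visits J F c ≤ escape m⁻¹ F + (F.filter fun f => m * (f * c) ∈ J).card := by
  unfold visits
  rw [← Finset.card_filter_add_card_filter_not (s := F.filter fun k => k * c ∈ J)
    (fun f => m⁻¹ * f ∉ F)]
  refine add_le_add (Finset.card_le_card fun f hf => ?_) ?_
  · simp only [Finset.mem_filter] at hf ⊢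
    exact ⟨hf.1.1, hf.2⟩
  · refine Finset.card_le_card_of_injOn (fun f => m⁻¹ * f) (fun f hf => ?_)
      (mul_right_injective _).injOn
    simp only [Finset.coe_filter, Finset.mem_filter, not_not, Set.mem_ofPred_eq] at hf ⊢
    refine ⟨hf.2, ?_⟩
    rw [mul_assoc, mul_inv_cancel_left]
    exact hf.1.2

theorem card_mul_visits_le (J : Set G) (M F : Finset G) (c : G) :
    M.card * visits J F c ≤ ∑ m ∈ M, escape m⁻¹ F + ∑ f ∈ F, visits J M (f * c) := by
  classical
  have h1 : ∑ f ∈ F, visits J M (f * c) =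
      ∑ m ∈ M, (F.filter fun f => m * (f * c) ∈ J).card := by
    simp only [visits, Finset.card_filter]
    exact Finset.sum_comm
  rw [h1, ← Finset.sum_add_distrib, ← smul_eq_mul, ← Finset.sum_const]
  exact Finset.sum_le_sum fun m _ => visits_le_escape_add J F c m

theorem IsFolnerSeq.eventually_visits_le {Fo : ℕ → Finset G} (hFo : IsFolnerSeq G Fo)
    {J : Set G} {M : Finset G} (hM : M.Nonempty) {r : ℝ}
    (h : ∀ c, (visits J M c : ℝ) ≤ r * M.card) {η : ℝ} (hη : 0 < η) :
    ∀ᶠ n in Filter.atTop, ∀ c, (visits J (Fo n) c : ℝ) ≤ (r + η) * (Fo n).card := by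
  classical
  have hMpos : (0 : ℝ) < M.card := by exact_mod_cast hM.card_pos
  filter_upwards [hFo.eventually_sum_escape_le (M.image (·⁻¹)) (mul_pos hη hMpos)] with n hn c
  rw [Finset.sum_image (by simp)] at hn
  have h1 : (M.card * visits J (Fo n) c : ℝ) ≤
      ∑ m ∈ M, (escape m⁻¹ (Fo n) : ℝ) + ∑ f ∈ Fo n, (visits J M (f * c) : ℝ) := by
    exact_mod_cast card_mul_visits_le J M (Fo n) c
  have h2 : ∑ f ∈ Fo n, (visits J M (f * c) : ℝ) ≤ (Fo n).card * (r * M.card) := by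
    rw [← nsmul_eq_mul, ← Finset.sum_const]
    exact Finset.sum_le_sum fun f _ => h _
  refine le_of_mul_le_mul_left ?_ hMpos
  linarith

theorem Thin.exists_le {J : Set G} {r : ℝ} (h : Thin J r) :
    ∃ r' < r, ∃ K : Finset G, K.Nonempty ∧ ∀ c, (visits J K c : ℝ) ≤ r' * K.card := by
  obtain ⟨K, hK, h⟩ := h
  have hKpos : (0 : ℝ) < K.card := by exact_mod_cast hK.card_pos
  obtain ⟨c₀, hc₀⟩ : ∃ c₀, ∀ c, visits J K c ≤ visits J K c₀ := by
    have hfin : (Set.range (visits J K)).Finite :=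
      (Set.finite_Iic K.card).subset (by rintro _ ⟨c, rfl⟩; exact visits_le_card J K c)
    obtain ⟨_, ⟨⟨c₀, rfl⟩, hc₀⟩⟩ := hfin.exists_maximal ⟨_, Set.mem_range_self 1⟩
    exact ⟨c₀, fun c => (le_total _ _).elim id fun h => hc₀ (Set.mem_range_self c) h⟩
  refine ⟨visits J K c₀ / K.card, by rw [div_lt_iff₀ hKpos]; exact h c₀, K, hK, fun c => ?_⟩
  rw [div_mul_cancel₀ _ hKpos.ne']
  exact_mod_cast hc₀ c

theorem Thin.mono {J J' : Set G} {r : ℝ} (h : Thin J r) (hJ : J' ⊆ J) : Thin J' r := by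
  obtain ⟨K, hK, h⟩ := h
  exact ⟨K, hK, fun c => lt_of_le_of_lt (by exact_mod_cast visits_mono hJ K c) (h c)⟩

theorem Thin.union (hG : IsAmenable G) {J J' : Set G} {r r' : ℝ} (h : Thin J r)
    (h' : Thin J' r') : Thin (J ∪ J') (r + r') := by
  obtain ⟨Fo, hFo⟩ := hG
  obtain ⟨s, hs, M, hM, hMs⟩ := h.exists_le
  obtain ⟨s', hs', M', hM', hMs'⟩ := h'.exists_le
  obtain ⟨n, h1, h2⟩ := ((hFo.eventually_visits_le hM hMs (η := (r - s) / 2)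
    (by linarith)).and (hFo.eventually_visits_le hM' hMs' (η := (r' - s') / 2)
    (by linarith))).exists
  have hpos : (0 : ℝ) < (Fo n).card := by exact_mod_cast (hFo.1 n).card_pos
  refine ⟨Fo n, hFo.1 n, fun c => ?_⟩
  have h3 : (visits (J ∪ J') (Fo n) c : ℝ) ≤ visits J (Fo n) c + visits J' (Fo n) c := by
    exact_mod_cast visits_union_le J J' (Fo n) c
  have h4 : (s + (r - s) / 2 + (s' + (r' - s') / 2)) * ((Fo n).card : ℝ) <
      (r + r') * (Fo n).card := by
    exact mul_lt_mul_of_pos_right (by linarith) hpos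
  linarith [h1 c, h2 c]

theorem not_thin_univ : ¬ Thin (Set.univ : Set G) 1 := by
  rintro ⟨K, -, h⟩
  simpa [visits] using h 1

theorem thin_empty {r : ℝ} (hr : 0 < r) : Thin (∅ : Set G) r :=
  ⟨{1}, by simp, fun c => by simpa [visits] using hr⟩

end Visits

section Recurrence

variable {G : Type*} [Group G]

theorem shiftAct_shiftAct {A : Type*} (c d : G) (x : G → A) :
    shiftAct c (shiftAct d x) = shiftAct (c * d) x := by
  funext g; simp [shiftAct, mul_assoc]

theorem shiftAct_one {A : Type*} (x : G → A) : shiftAct 1 x = x := by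
  funext g; simp [shiftAct]

theorem continuous_shiftAct {A : Type*} [TopologicalSpace A] (c : G) :
    Continuous (shiftAct c : (G → A) → G → A) :=
  continuous_pi fun g => continuous_apply (g * c)

/-- Every finite pattern at the identity recurs along a syndetic set. -/
def IsUniformlyRecurrent {A : Type*} (w : G → A) : Prop :=
  ∀ K : Finset G, ∃ F : Finset G, ∀ g, ∃ f ∈ F, ∀ k ∈ K, w (k * (f * g)) = w k

theorem IsUniformlyRecurrent.comp {A B : Type*} {w : G → A} (hw : IsUniformlyRecurrent w)
    (φ : A → B) : IsUniformlyRecurrent fun g => φ (w g) := by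
  intro K
  obtain ⟨F, hF⟩ := hw K
  refine ⟨F, fun g => ?_⟩
  obtain ⟨f, hf, h⟩ := hF g
  exact ⟨f, hf, fun k hk => congrArg φ (h k hk)⟩

theorem exists_minimal_closed_invariant {I Ω : Type*} [TopologicalSpace Ω] [CompactSpace Ω]
    (T : I → Ω → Ω) {S : Set Ω} (hS : IsClosed S) (hne : S.Nonempty)
    (hinv : ∀ c, ∀ x ∈ S, T c x ∈ S) :
    ∃ M ⊆ S, M.Nonempty ∧ IsClosed M ∧ (∀ c, ∀ x ∈ M, T c x ∈ M) ∧
      ∀ M' ⊆ M, M'.Nonempty → IsClosed M' → (∀ c, ∀ x ∈ M', T c x ∈ M') → M' = M := by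
  obtain ⟨M, hMS, hM⟩ := zorn_superset_nonempty
    {M : Set Ω | M.Nonempty ∧ IsClosed M ∧ ∀ c, ∀ x ∈ M, T c x ∈ M} (fun C hC hchain hCne => by
      refine ⟨⋂₀ C, ⟨?_, isClosed_sInter fun s hs => (hC hs).2.1, fun c x hx s hs =>
        (hC hs).2.2 c x (hx s hs)⟩, fun s hs => Set.sInter_subset_of_mem hs⟩
      have : Nonempty C := hCne.to_subtype
      rw [Set.sInter_eq_iInter]
      refine IsCompact.nonempty_iInter_of_directed_nonempty_isCompact_isClosed _ ?_
        (fun s => (hC s.2).1) (fun s => (hC s.2).2.1.isCompact) fun s => (hC s.2).2.1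
      rintro ⟨s, hs⟩ ⟨t, ht⟩
      rcases hchain.total hs ht with h | h
      · exact ⟨⟨s, hs⟩, subset_rfl, h⟩
      · exact ⟨⟨t, ht⟩, h, subset_rfl⟩) S ⟨hne, hS, hinv⟩
  exact ⟨M, hMS, hM.prop.1, hM.prop.2.1, hM.prop.2.2, fun M' hsub hne' hcl hinv' =>
    hsub.antisymm (hM.le_of_le ⟨hne', hcl, hinv'⟩ hsub)⟩

theorem mem_closure_iff_forall_finset {I A : Type*} [TopologicalSpace A] [DiscreteTopology A]
    {s : Set (I → A)} {x : I → A} :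
    x ∈ closure s ↔ ∀ K : Finset I, ∃ y ∈ s, ∀ k ∈ K, y k = x k := by
  constructor
  · intro h K
    obtain ⟨y, hy, hys⟩ := mem_closure_iff.1 h (⋂ k ∈ K, (fun y : I → A => y k) ⁻¹' {x k})
      (isOpen_biInter_finset fun k _ => (isOpen_discrete _).preimage (continuous_apply k))
      (by simp)
    exact ⟨y, hys, by simpa using hy⟩
  · intro h
    rw [mem_closure_iff]
    intro o ho hx
    obtain ⟨K, u, hu, hsub⟩ := isOpen_pi_iff.1 ho x hx
    obtain ⟨y, hy, hyx⟩ := h K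
    exact ⟨y, hsub fun i hi => by rw [hyx i hi]; exact (hu i hi).2, hy⟩

theorem isOpen_forall_finset_eq {I A : Type*} [TopologicalSpace A] [DiscreteTopology A]
    (K : Finset I) (w : I → A) : IsOpen {y : I → A | ∀ k ∈ K, y k = w k} := by
  have : {y : I → A | ∀ k ∈ K, y k = w k} = ⋂ k ∈ K, (fun y : I → A => y k) ⁻¹' {w k} := by
    ext; simp
  rw [this]
  exact isOpen_biInter_finset fun k _ => (isOpen_discrete _).preimage (continuous_apply k)

theorem isClosed_forall_finset_eq {I A B : Type*} [TopologicalSpace A] [DiscreteTopology A]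
    (K : Finset I) (φ : A → B) (w : I → B) : IsClosed {y : I → A | ∀ k ∈ K, φ (y k) = w k} := by
  have : {y : I → A | ∀ k ∈ K, φ (y k) = w k} =
      ⋂ k ∈ K, (fun y : I → A => y k) ⁻¹' (φ ⁻¹' {w k}) := by
    ext; simp
  rw [this]
  exact isClosed_biInter fun k _ => (isClosed_discrete _).preimage (continuous_apply k)

/-- Points of minimal subshifts are uniformly recurrent. -/
theorem isUniformlyRecurrent_of_minimal {A : Type*} [TopologicalSpace A] [DiscreteTopology A]
    [Finite A] {M : Set (G → A)} (hcl : IsClosed M) (hinv : ∀ c, ∀ x ∈ M, shiftAct c x ∈ M)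
    (hmin : ∀ M' ⊆ M, M'.Nonempty → IsClosed M' → (∀ c, ∀ x ∈ M', shiftAct (c : G) x ∈ M') →
      M' = M) {q : G → A} (hq : q ∈ M) : IsUniformlyRecurrent q := by
  intro K
  let U : Set (G → A) := {y | ∀ k ∈ K, y k = q k}
  have hU : IsOpen U := isOpen_forall_finset_eq K q
  have hcov : M ⊆ ⋃ c : G, shiftAct c ⁻¹' U := by
    by_contra hcon
    obtain ⟨x, hxM, hx⟩ := Set.not_subset.1 hcon
    have hM' := hmin {y ∈ M | ∀ c : G, shiftAct c y ∉ U} (fun y hy => hy.1)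
      ⟨x, hxM, fun c hc => hx (Set.mem_iUnion.2 ⟨c, hc⟩)⟩ ?_ ?_
    · have hq' : q ∈ {y ∈ M | ∀ c : G, shiftAct c y ∉ U} := hM'.symm ▸ hq
      exact hq'.2 1 (by rw [shiftAct_one]; exact fun k _ => rfl)
    · have : {y ∈ M | ∀ c : G, shiftAct c y ∉ U} = M ∩ ⋂ c : G, (shiftAct c ⁻¹' U)ᶜ := by
        ext; simp
      rw [this]
      exact hcl.inter (isClosed_iInter fun c =>
        (hU.preimage (continuous_shiftAct c)).isClosed_compl)
    · exact fun c y hy => ⟨hinv c y hy.1, fun d => by rw [shiftAct_shiftAct]; exact hy.2 _⟩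
  obtain ⟨F, hF⟩ := hcl.isCompact.elim_finite_subcover _
    (fun c => hU.preimage (continuous_shiftAct c)) hcov
  refine ⟨F, fun g => ?_⟩
  obtain ⟨f, hf, hfU⟩ := Set.mem_iUnion₂.1 (hF (hinv g q hq))
  refine ⟨f, hf, fun k hk => ?_⟩
  have := hfU k hk
  simpa [shiftAct, mul_assoc] using this

/-- A uniformly recurrent configuration extends to a uniformly recurrent pair whose finite patterns
all occur in a prescribed extension. -/
theorem IsUniformlyRecurrent.exists_extension {A B : Type*} {w : G → A}
    (hw : IsUniformlyRecurrent w) (hwfin : (Set.range w).Finite) (v₀ : G → B)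
    (hvfin : (Set.range v₀).Finite) :
    ∃ v : G → B, IsUniformlyRecurrent (fun g => (w g, v g)) ∧
      ∀ (K : Finset G) (g : G), ∃ g', ∀ k ∈ K,
        w (k * g) = w (k * g') ∧ v (k * g) = v₀ (k * g') := by
  classical
  let C := Set.range w × Set.range v₀
  have : Finite (Set.range w) := hwfin
  have : Finite (Set.range v₀) := hvfin
  let _ : TopologicalSpace C := ⊥
  have : DiscreteTopology C := ⟨rfl⟩
  let p : G → C := fun g => (⟨w g, g, rfl⟩, ⟨v₀ g, g, rfl⟩)
  obtain ⟨M, hMO, hMne, hMcl, hMinv, hMmin⟩ := exists_minimal_closed_invariant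
    (fun (c : G) (x : G → C) => shiftAct c x)
    (isClosed_closure (s := Set.range fun c : G => shiftAct c p))
    ⟨p, subset_closure ⟨1, shiftAct_one p⟩⟩ (by
      intro c x hx
      refine map_mem_closure (continuous_shiftAct c) hx ?_
      rintro _ ⟨d, rfl⟩
      exact ⟨c * d, (shiftAct_shiftAct c d p).symm⟩)
  have hlocal : ∀ q ∈ M, ∀ K : Finset G, ∃ d : G, ∀ k ∈ K, q k = p (k * d) := by
    intro q hq K
    obtain ⟨_, ⟨d, rfl⟩, hd⟩ := mem_closure_iff_forall_finset.1 (hMO hq) K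
    exact ⟨d, fun k hk => (hd k hk).symm⟩
  obtain ⟨q, hq⟩ : (⋂ K : Finset G, M ∩ {y : G → C | ∀ k ∈ K, ((y k).1 : A) = w k}).Nonempty := by
    have hcl : ∀ K : Finset G, IsClosed (M ∩ {y : G → C | ∀ k ∈ K, ((y k).1 : A) = w k}) :=
      fun K => hMcl.inter (isClosed_forall_finset_eq K (fun c : C => (c.1 : A)) w)
    refine IsCompact.nonempty_iInter_of_directed_nonempty_isCompact_isClosed _ ?_ ?_
      (fun K => (hcl K).isCompact) hcl
    · refine directed_of_isDirected_le fun K K' hK y hy => ⟨hy.1, fun k hk => hy.2 k (Finset.mem_of_subset hK hk)⟩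
    · intro K
      obtain ⟨F, hF⟩ := hw K
      obtain ⟨m, hm⟩ := hMne
      obtain ⟨d, hd⟩ := hlocal m hm (K * F)
      obtain ⟨f, hf, hfw⟩ := hF d
      refine ⟨shiftAct f m, hMinv f m hm, fun k hk => ?_⟩
      simp only [shiftAct]
      rw [hd _ (Finset.mul_mem_mul hk hf), ← hfw k hk]
      simp [p, mul_assoc]
  have hqM : q ∈ M := (Set.mem_iInter.1 hq ∅).1
  have hqw : ∀ g, ((q g).1 : A) = w g := fun g => (Set.mem_iInter.1 hq {g}).2 g (by simp)
  have hur := isUniformlyRecurrent_of_minimal hMcl hMinv hMmin hqM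
  refine ⟨fun g => (q g).2, ?_, fun K g => ?_⟩
  · have := hur.comp fun c : C => ((c.1 : A), (c.2 : B))
    simpa only [hqw] using this
  · obtain ⟨d, hd⟩ := hlocal q hqM (K * {g})
    refine ⟨g * d, fun k hk => ?_⟩
    have h1 := hd _ (Finset.mul_mem_mul hk (Finset.mem_singleton_self g))
    rw [mul_assoc] at h1
    exact ⟨(hqw _).symm.trans (congrArg (fun c : C => (c.1 : A)) h1),
      congrArg (fun c : C => (c.2 : B)) h1⟩

end Recurrence

section Colouring

variable {G : Type*} [Group G]

/-- A greedy colouring: a countable group has a finite colouring in which distinct points of the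
same colour never differ by an element of `D`. -/
theorem exists_colouring [Countable G] (D : Finset G) :
    ∃ (n : ℕ) (v : G → ℕ), (∀ g, v g < n) ∧
      ∀ g g', g ≠ g' → v g = v g' → g * g'⁻¹ ∉ D := by
  classical
  obtain ⟨enc, henc⟩ := exists_injective_nat G
  let D' := D ∪ D⁻¹
  let v : G → ℕ := (measure enc).wf.fix fun g ih =>
    sInf {k | ∀ g' (h : enc g' < enc g), g * g'⁻¹ ∈ D' → ih g' h ≠ k}
  have hv : ∀ g, v g = sInf {k | ∀ g', enc g' < enc g → g * g'⁻¹ ∈ D' → v g' ≠ k} :=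
    fun g => (measure enc).wf.fix_eq _ g
  have hfree : ∀ g, ∃ k < D'.card + 1, ∀ g', enc g' < enc g → g * g'⁻¹ ∈ D' → v g' ≠ k := by
    intro g
    by_contra! hcon
    have hsub : Finset.range (D'.card + 1) ⊆ D'.image fun d => v (d⁻¹ * g) := by
      intro k hk
      obtain ⟨g', -, hd, hk'⟩ := hcon k (Finset.mem_range.1 hk)
      exact Finset.mem_image.2 ⟨_, hd, by simpa using hk'⟩
    have := (Finset.card_le_card hsub).trans Finset.card_image_le
    simp at this
  have hmem : ∀ g g', enc g' < enc g → g * g'⁻¹ ∈ D' → v g' ≠ v g := by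
    intro g
    obtain ⟨k, -, hk⟩ := hfree g
    have := Nat.sInf_mem (s := {k | ∀ g', enc g' < enc g → g * g'⁻¹ ∈ D' → v g' ≠ k}) ⟨k, hk⟩
    rw [← hv] at this
    exact this
  refine ⟨D'.card + 1, v, fun g => ?_, fun g g' hne hvv hD => ?_⟩
  · obtain ⟨k, hk, hk'⟩ := hfree g
    rw [hv]
    exact (Nat.sInf_le (s := {k | ∀ g', enc g' < enc g → g * g'⁻¹ ∈ D' → v g' ≠ k}) hk').trans_lt hk
  · rcases lt_trichotomy (enc g') (enc g) with h | h | h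
    · exact hmem g g' h (Finset.mem_union_left _ hD) hvv.symm
    · exact hne (henc h.symm)
    · refine hmem g' g h (Finset.mem_union_right _ ?_) hvv
      rw [Finset.mem_inv]
      exact ⟨_, hD, by simp⟩

/-- Maximal separated subsets. -/
theorem exists_maximal_separated (R : Set G) (D : Finset G) :
    ∃ C ⊆ R, (∀ c ∈ C, ∀ c' ∈ C, c ≠ c' → c * c'⁻¹ ∉ D) ∧
      ∀ g ∈ R, ∃ c ∈ C, g = c ∨ g * c⁻¹ ∈ D ∨ c * g⁻¹ ∈ D := by
  obtain ⟨C, -, hC⟩ := zorn_subset_nonempty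
    {C : Set G | C ⊆ R ∧ ∀ c ∈ C, ∀ c' ∈ C, c ≠ c' → c * c'⁻¹ ∉ D} (fun 𝒞 h𝒞 hchain _ => by
      refine ⟨⋃₀ 𝒞, ⟨Set.sUnion_subset fun C hC => (h𝒞 hC).1, ?_⟩,
        fun s hs => Set.subset_sUnion_of_mem hs⟩
      rintro c ⟨s, hs, hcs⟩ c' ⟨s', hs', hcs'⟩
      rcases hchain.total hs hs' with h | h
      · exact (h𝒞 hs').2 c (h hcs) c' hcs'
      · exact (h𝒞 hs).2 c hcs c' (h hcs')) ∅ ⟨Set.empty_subset _, by simp⟩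
  refine ⟨C, hC.prop.1, hC.prop.2, fun g hg => ?_⟩
  by_contra! hcon
  have hgC : g ∉ C := fun h => (hcon g h).1 rfl
  refine hgC (hC.le_of_ge (y := insert g C) ⟨Set.insert_subset hg hC.prop.1, ?_⟩
    (Set.subset_insert g C) (Set.mem_insert g C))
  rintro c (rfl | hc) c' (rfl | hc') hne
  · exact absurd rfl hne
  · exact (hcon c' hc').2.1
  · exact (hcon c hc).2.2
  · exact hC.prop.2 c hc c' hc' hne

/-- Finitely many infinite sets have representatives with differences avoiding a finite set. -/
theorem exists_separated_representatives {ι : Type*} [Finite ι] (S : ι → Set G)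
    (hS : ∀ i, (S i).Infinite) (B : Finset G) :
    ∃ d : ι → G, (∀ i, d i ∈ S i) ∧ ∀ i j, i ≠ j → d i * (d j)⁻¹ ∉ B := by
  classical
  have := Fintype.ofFinite ι
  have key : ∀ T : Finset ι, ∃ d : ι → G, (∀ i ∈ T, d i ∈ S i) ∧
      ∀ i ∈ T, ∀ j ∈ T, i ≠ j → d i * (d j)⁻¹ ∉ B := by
    intro T
    induction T using Finset.induction_on with
    | empty => exact ⟨fun _ => 1, by simp, by simp⟩
    | insert i T hi ih =>
      obtain ⟨d, hd, hdd⟩ := ih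
      obtain ⟨x, hxS, hx⟩ := (hS i).exists_notMem_finset (B * T.image d ∪ B⁻¹ * T.image d)
      have hx1 : ∀ j ∈ T, x * (d j)⁻¹ ∉ B := fun j hj h => hx <| Finset.mem_union_left _ <|
        Finset.mem_mul.2 ⟨_, h, d j, Finset.mem_image_of_mem d hj, by simp⟩
      have hx2 : ∀ j ∈ T, d j * x⁻¹ ∉ B := fun j hj h => hx <| Finset.mem_union_right _ <|
        Finset.mem_mul.2 ⟨_, Finset.inv_mem_inv h, d j, Finset.mem_image_of_mem d hj, by simp⟩
      have hne : ∀ j ∈ T, j ≠ i := fun j hj h => hi (h ▸ hj)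
      refine ⟨Function.update d i x, ?_, ?_⟩
      · intro j hj
        rcases Finset.mem_insert.1 hj with rfl | hj
        · simpa using hxS
        · rw [Function.update_of_ne (hne j hj)]; exact hd j hj
      · intro j hj k hk hjk
        rcases Finset.mem_insert.1 hj with rfl | hjT <;> rcases Finset.mem_insert.1 hk with rfl | hkT
        · exact absurd rfl hjk
        · rw [Function.update_self, Function.update_of_ne (hne k hkT)]; exact hx1 k hkT
        · rw [Function.update_self, Function.update_of_ne (hne j hjT)]; exact hx2 j hjT
        · rw [Function.update_of_ne (hne j hjT), Function.update_of_ne (hne k hkT)]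
          exact hdd j hjT k hkT hjk
  obtain ⟨d, h1, h2⟩ := key Finset.univ
  exact ⟨d, fun i => h1 i (Finset.mem_univ i),
    fun i j => h2 i (Finset.mem_univ i) j (Finset.mem_univ j)⟩

theorem visits_le_one_of_separated {J : Set G} {E : Finset G}
    (h : ∀ g ∈ J, ∀ g' ∈ J, g ≠ g' → ∀ e ∈ E, ∀ e' ∈ E, g * g'⁻¹ ≠ e * e'⁻¹) (c : G) :
    visits J E c ≤ 1 := by
  classical
  unfold visits
  refine Finset.card_le_one.2 fun e he e' he' => ?_
  rw [Finset.mem_filter] at he he'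
  by_contra hne
  exact h _ he.2 _ he'.2 (fun h => hne (mul_right_cancel h)) e he.1 e' he'.1 (by group)

end Colouring

section Filling

variable {G P : Type*}

/-- `w'` extends the partial configuration `w`. -/
def Extends (w' w : G → Option P) : Prop := ∀ g p, w g = some p → w' g = some p

theorem Extends.trans {w w' w'' : G → Option P} (h' : Extends w'' w') (h : Extends w' w) :
    Extends w'' w := fun g p hp => h' g p (h g p hp)

/-- The set of sites left free by a partial configuration. -/
def freeSites (w : G → Option P) : Set G := {g | w g = none}

variable [Group G]

/-- Filling sites one colour class at a time brings the density of the free sites just above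
`ρ`. -/
theorem exists_extends_thin [Countable G] [Infinite G] [Nonempty P] (hG : IsAmenable G)
    {w : G → Option P} (hfin : (Set.range w).Finite) (hw : IsUniformlyRecurrent w) {ρ r : ℝ}
    (hρ : 0 < ρ) (hr : ρ < r) (hthin : ¬ Thin (freeSites w) r) {ε : ℝ} (hε : 0 < ε) :
    ∃ w' : G → Option P, (Set.range w').Finite ∧ IsUniformlyRecurrent w' ∧ Extends w' w ∧
      (∃ r' > ρ, ¬ Thin (freeSites w') r') ∧ Thin (freeSites w') (ρ + ε) := by
  classical
  by_cases hdone : Thin (freeSites w) (ρ + ε)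
  · exact ⟨w, hfin, hw, fun _ _ h => h, ⟨r, hr, hthin⟩, hdone⟩
  obtain ⟨m, hm⟩ := exists_nat_gt (1 / (ε / 2))
  obtain ⟨E, hE⟩ := Infinite.exists_subset_card_eq G m
  have hEε : 1 < ε / 2 * E.card := by
    rw [hE]; rwa [div_lt_iff₀' (by positivity)] at hm
  obtain ⟨n, v₀, hv₀n, hv₀⟩ := exists_colouring (E * E⁻¹)
  obtain ⟨v, hur, hloc⟩ := hw.exists_extension hfin v₀
    ((Set.finite_Iio n).subset (by rintro _ ⟨g, rfl⟩; exact hv₀n g))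
  have hvn : ∀ g, v g < n := fun g => by
    obtain ⟨g', hg'⟩ := hloc {1} g
    have := (hg' 1 (by simp)).2
    rw [one_mul] at this
    rw [this]; exact hv₀n _
  have hvsep : ∀ g g', g ≠ g' → v g = v g' → g * g'⁻¹ ∉ E * E⁻¹ := by
    intro g g' hne hvv
    obtain ⟨h, hh⟩ := hloc {1, g' * g⁻¹} g
    have h1 := (hh 1 (by simp)).2
    have h2 := (hh (g' * g⁻¹) (by simp)).2
    rw [one_mul] at h1
    rw [inv_mul_cancel_right] at h2
    have h3 := hv₀ (1 * h) (g' * g⁻¹ * h) (fun he => hne ?_) (by rw [← h1, ← h2, hvv])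
    · simpa using h3
    · have := mul_right_cancel he
      exact (mul_inv_eq_one.1 this.symm).symm
  obtain ⟨p₀⟩ := ‹Nonempty P›
  let u : ℕ → G → Option P := fun i g => if v g < i then (w g).or (some p₀) else w g
  have hmem : ∀ i g, g ∈ freeSites (u i) ↔ g ∈ freeSites w ∧ i ≤ v g := by
    intro i g
    simp only [freeSites, Set.mem_ofPred_eq, u]
    split_ifs with h
    · simp [h]
    · simp [not_lt.1 h]
  have hthin0 : ¬ Thin (freeSites (u 0)) (ρ + ε / 2) := by
    intro h
    refine hdone ?_
    obtain ⟨K, hK, h⟩ := h.mono (J' := freeSites w) fun g hg => (hmem 0 g).2 ⟨hg, Nat.zero_le _⟩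
    refine ⟨K, hK, fun c => (h c).trans_le ?_⟩
    gcongr
    linarith
  have hex : ∃ i, Thin (freeSites (u i)) (ρ + ε) := by
    refine ⟨n, ?_⟩
    have : freeSites (u n) = ∅ := by
      ext g
      simp [hmem, hvn g]
    rw [this]
    exact thin_empty (by linarith)
  obtain ⟨i, hi, hi'⟩ : ∃ i, Thin (freeSites (u i)) (ρ + ε) ∧
      ¬ Thin (freeSites (u i)) (ρ + ε / 2) := by
    rcases hi : Nat.find hex with - | i
    · exact ⟨0, hi ▸ Nat.find_spec hex, hthin0⟩
    · refine ⟨i + 1, hi ▸ Nat.find_spec hex, fun hcon => ?_⟩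
      have hclass : Thin {g | v g = i} (ε / 2) := by
        refine ⟨E, ?_, fun c => lt_of_le_of_lt ?_ hEε⟩
        · rw [Finset.nonempty_iff_ne_empty]
          rintro rfl
          simp at hEε
          linarith
        · have := visits_le_one_of_separated (J := {g | v g = i}) (E := E)
            (fun g hg g' hg' hne e he e' he' heq => hvsep g g' hne (Eq.trans hg hg'.symm)
              (heq ▸ Finset.mul_mem_mul he (Finset.inv_mem_inv he'))) c
          exact_mod_cast this
      have h1 := (hcon.union hG hclass).mono (J' := freeSites (u i)) (by
        intro g hg
        obtain ⟨h1, h2⟩ := (hmem i g).1 hg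
        rcases h2.eq_or_lt with h | h
        · exact Or.inr h.symm
        · exact Or.inl ((hmem _ g).2 ⟨h1, h⟩))
      refine Nat.find_min hex (m := i) (by omega) ?_
      convert h1 using 1
      ring
  refine ⟨u i, ?_, ?_, ?_, ⟨ρ + ε / 2, by linarith, hi'⟩, hi⟩
  · refine (hfin.union (Set.finite_singleton (some p₀))).subset ?_
    rintro _ ⟨g, rfl⟩
    simp only [u]
    split_ifs
    · rcases h : w g with - | p
      · right; simp
      · left; exact ⟨g, by simp [h]⟩
    · exact Or.inl ⟨g, rfl⟩
  · exact hur.comp fun q : Option P × ℕ => if q.2 < i then q.1.or (some p₀) else q.1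
  · intro g p hp
    simp only [u]
    split_ifs <;> simp [hp]

end Filling

section Patterns

variable {G : Type*} [Group G] {P : Type*}

theorem IsUniformlyRecurrent.infinite_compatible [Infinite G] {w : G → Option P}
    (hw : IsUniformlyRecurrent w) (K : Finset G) (u : K → P)
    (hu : ∃ g : G, ∀ (k : K) (p : P), w (k * g) = some p → u k = p) :
    {g : G | ∀ (k : K) (p : P), w (k * g) = some p → u k = p}.Infinite := by
  classical
  intro hfin
  obtain ⟨g₀, hg₀⟩ := hu
  obtain ⟨F, hF⟩ := hw (K * {g₀})
  have hcov : (Set.univ : Set G) ⊆ (F : Set G)⁻¹ * ({g₀⁻¹} *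
      {g : G | ∀ (k : K) (p : P), w (k * g) = some p → u k = p}) := by
    intro g _
    obtain ⟨f, hf, h⟩ := hF g
    refine Set.mem_mul.2 ⟨f⁻¹, by simpa using hf, f * g, Set.mem_mul.2 ⟨g₀⁻¹, rfl,
      g₀ * (f * g), fun k p hp => hg₀ k p ?_, by simp⟩, by simp⟩
    rw [← h _ (Finset.mul_mem_mul k.2 (Finset.mem_singleton_self g₀)), mul_assoc]
    exact hp
  exact Set.infinite_univ ((F.finite_toSet.inv.mul ((Set.finite_singleton _).mul hfin)).subset
    hcov)

/-- A finite window and a completion of `w` on it displaying all compatible patterns. -/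
theorem exists_pattern_window [Infinite G] [Nonempty P] {w : G → Option P}
    (hw : IsUniformlyRecurrent w) (K : Finset G) (A : Finset P) :
    ∃ (L : Finset G) (z : G → P), (∀ l ∈ L, ∀ p, w l = some p → z l = p) ∧
      ∀ u : K → A, (∃ g : G, ∀ (k : K) (p : P), w (k * g) = some p → (u k : P) = p) →
        ∃ d : G, ∀ k : K, (k : G) * d ∈ L ∧ z (k * d) = u k := by
  classical
  let ι := {u : K → A // ∃ g : G, ∀ (k : K) (p : P), w (k * g) = some p → (u k : P) = p}
  have : Fintype ι := Fintype.ofFinite ι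
  obtain ⟨d, hd, hdd⟩ := exists_separated_representatives
    (fun u : ι => {g : G | ∀ (k : K) (p : P), w (k * g) = some p → (u.1 k : P) = p})
    (fun u => hw.infinite_compatible K (fun k => u.1 k) u.2) (K⁻¹ * K)
  have huniq : ∀ (u u' : ι) (k k' : K), (k : G) * d u = k' * d u' → u = u' ∧ k = k' := by
    intro u u' k k' h
    have hu : u = u' := by
      by_contra hne
      refine hdd u u' hne (Finset.mem_mul.2 ⟨_, Finset.inv_mem_inv k.2, _, k'.2, ?_⟩)
      rw [inv_mul_eq_iff_eq_mul, ← mul_assoc, h]; simp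
    subst hu
    exact ⟨rfl, Subtype.ext (mul_right_cancel h)⟩
  have hz : ∀ g : G, ∃ p : P, ∀ (u : ι) (k : K), g = k * d u → p = u.1 k := by
    intro g
    by_cases h : ∃ (u : ι) (k : K), g = k * d u
    · obtain ⟨u, k, rfl⟩ := h
      refine ⟨u.1 k, fun u' k' h => ?_⟩
      obtain ⟨rfl, rfl⟩ := huniq _ _ _ _ h
      rfl
    · push Not at h
      exact ⟨Classical.arbitrary P, fun u k hg => absurd hg (h u k)⟩
  choose z hz using hz
  refine ⟨Finset.univ.image fun q : ι × K => (q.2 : G) * d q.1, z, ?_, ?_⟩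
  · intro l hl p hp
    obtain ⟨⟨u, k⟩, -, rfl⟩ := Finset.mem_image.1 hl
    rw [hz _ u k rfl]
    exact hd u k p hp
  · exact fun u hu => ⟨d ⟨u, hu⟩, fun k => ⟨Finset.mem_image.2
      ⟨(⟨u, hu⟩, k), Finset.mem_univ _, rfl⟩, hz _ ⟨u, hu⟩ k rfl⟩⟩

/-- Copying a completed window along a sparse syndetic set. -/
theorem exists_sparse_copies {w : G → Option P} (hw : IsUniformlyRecurrent w) (L E : Finset G)
    (hE : 1 ∈ E) (z : G → P) (hz : ∀ l ∈ L, ∀ p, w l = some p → z l = p) :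
    ∃ w' : G → Option P, (∀ g, w' g = w g ∨ ∃ l ∈ L, w' g = some (z l)) ∧ Extends w' w ∧
      (∀ c, visits {g | w g = none ∧ w' g ≠ none} E c ≤ L.card) ∧
      ∃ F : Finset G, ∀ g, ∃ f ∈ F, ∀ l ∈ L, w' (l * (f * g)) = some (z l) := by
  classical
  let D := L⁻¹ * (E * E⁻¹) * L
  obtain ⟨F, hF⟩ := hw L
  obtain ⟨C, hCR, hCsep, hCmax⟩ := exists_maximal_separated {c | ∀ l ∈ L, w (l * c) = w l} D
  have hsep : ∀ c ∈ C, ∀ c' ∈ C, ∀ l ∈ L, ∀ l' ∈ L, ∀ e ∈ E, ∀ e' ∈ E, ∀ g,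
      l * c = e * g → l' * c' = e' * g → c = c' := by
    intro c hc c' hc' l hl l' hl' e he e' he' g h h'
    by_contra hne
    refine hCsep c hc c' hc' hne ?_
    have : c * c'⁻¹ = l⁻¹ * (e * e'⁻¹) * l' := by
      rw [← eq_inv_mul_iff_mul_eq] at h h'
      rw [h, h']; group
    rw [this]
    exact Finset.mul_mem_mul (Finset.mul_mem_mul (Finset.inv_mem_inv hl)
      (Finset.mul_mem_mul he (Finset.inv_mem_inv he'))) hl'
  have hval : ∀ g : G, ∃ o : Option P, (∀ c ∈ C, ∀ l ∈ L, g = l * c → o = some (z l)) ∧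
      ((∀ c ∈ C, ∀ l ∈ L, g ≠ l * c) → o = w g) := by
    intro g
    by_cases h : ∃ c ∈ C, ∃ l ∈ L, g = l * c
    · obtain ⟨c, hc, l, hl, rfl⟩ := h
      refine ⟨some (z l), fun c' hc' l' hl' h => ?_, fun h => absurd rfl (h c hc l hl)⟩
      have := hsep c hc c' hc' l hl l' hl' 1 hE 1 hE (l * c) (by simp) (by simp [h])
      subst this
      rw [mul_right_cancel h]
    · push Not at h
      exact ⟨w g, fun c hc l hl hg => absurd hg (h c hc l hl), fun _ => rfl⟩
  choose w' hw'1 hw'2 using hval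
  refine ⟨w', fun g => ?_, fun g p hp => ?_, fun g => ?_,
    F ∪ (D * F ∪ D⁻¹ * F), fun g => ?_⟩
  · by_cases h : ∃ c ∈ C, ∃ l ∈ L, g = l * c
    · obtain ⟨c, hc, l, hl, rfl⟩ := h
      exact Or.inr ⟨l, hl, hw'1 _ c hc l hl rfl⟩
    · push Not at h
      exact Or.inl (hw'2 g h)
  · by_cases h : ∃ c ∈ C, ∃ l ∈ L, g = l * c
    · obtain ⟨c, hc, l, hl, rfl⟩ := h
      rw [hw'1 _ c hc l hl rfl]
      rw [hCR hc l hl] at hp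
      rw [hz l hl p hp]
    · push Not at h
      rw [hw'2 g h, hp]
  · have hhit : ∀ e, e * g ∈ {g | w g = none ∧ w' g ≠ none} → ∃ c ∈ C, ∃ l ∈ L, e * g = l * c := by
      intro e he
      by_contra! hcon
      exact he.2 ((hw'2 _ hcon).trans he.1)
    by_cases hne : ∃ e₀ ∈ E, e₀ * g ∈ {g | w g = none ∧ w' g ≠ none}
    · obtain ⟨e₀, he₀, he₀'⟩ := hne
      obtain ⟨c, hc, l, hl, h⟩ := hhit e₀ he₀'
      refine visits_le_card_of_injective (f := fun e => e * g * c⁻¹)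
        (fun e e' h => by simpa using h) fun e he he' => ?_
      obtain ⟨c', hc', l', hl', h'⟩ := hhit e he'
      have := hsep c hc c' hc' l hl l' hl' e₀ he₀ e he g h.symm h'.symm
      subst this
      simpa [h'] using hl'
    · push Not at hne
      exact visits_le_card_of_injective Function.injective_id fun e he he' => absurd he' (hne e he)
  · obtain ⟨f, hf, hfg⟩ := hF g
    obtain ⟨c, hc, hcg⟩ := hCmax (f * g) hfg
    have hc' : ∀ l ∈ L, w' (l * c) = some (z l) := fun l hl => hw'1 _ c hc l hl rfl
    have hcg' : ∃ f' ∈ F ∪ (D * F ∪ D⁻¹ * F), c = f' * g := by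
      rcases hcg with h | h | h
      · exact ⟨f, Finset.mem_union_left _ hf, h.symm⟩
      · refine ⟨(f * g * c⁻¹)⁻¹ * f, Finset.mem_union_right _ (Finset.mem_union_right _
          (Finset.mul_mem_mul (Finset.inv_mem_inv h) hf)), by group⟩
      · refine ⟨(c * (f * g)⁻¹) * f, Finset.mem_union_right _ (Finset.mem_union_left _
          (Finset.mul_mem_mul h hf)), by group⟩
    obtain ⟨f', hf', rfl⟩ := hcg'
    exact ⟨f', hf', hc'⟩

/-- All patterns over `A` compatible with `w` can be made to occur syndetically at an arbitrarily
small cost in the density of free sites. -/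
theorem exists_extends_patterns [Infinite G] [Nonempty P] (hG : IsAmenable G)
    {w : G → Option P} (hfin : (Set.range w).Finite) (hw : IsUniformlyRecurrent w) {ρ r : ℝ}
    (hr : ρ < r) (hthin : ¬ Thin (freeSites w) r) (K : Finset G) (A : Finset P) :
    ∃ w' : G → Option P, (Set.range w').Finite ∧ IsUniformlyRecurrent w' ∧ Extends w' w ∧
      (∃ r' > ρ, ¬ Thin (freeSites w') r') ∧ ∃ F : Finset G, ∀ u : K → A,
        (∃ g : G, ∀ (k : K) (p : P), w (k * g) = some p → (u k : P) = p) →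
          ∀ g : G, ∃ f ∈ F, ∀ k : K, w' (k * (f * g)) = some (u k : P) := by
  classical
  obtain ⟨L, z, hz, hu⟩ := exists_pattern_window hw K A
  obtain ⟨m, hm⟩ := exists_nat_gt (L.card / ((r - ρ) / 2))
  obtain ⟨E, hE1, hEm⟩ := Infinite.exists_superset_card_eq ({1} : Finset G) (m + 1) (by simp)
  have h1E : 1 ∈ E := hE1 (Finset.mem_singleton_self 1)
  have hEL : (L.card : ℝ) < (r - ρ) / 2 * E.card := by
    rw [hEm]
    rw [div_lt_iff₀' (by linarith)] at hm
    refine hm.trans_le ?_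
    push_cast
    nlinarith
  obtain ⟨w₀, hval, hext, hvis, F, hF⟩ := exists_sparse_copies hw L E h1E z hz
  have hfin₀ : (Set.range w₀).Finite := by
    refine (hfin.union ((L.finite_toSet.image fun l => some (z l)))).subset ?_
    rintro _ ⟨g, rfl⟩
    rcases hval g with h | ⟨l, hl, h⟩
    · exact Or.inl ⟨g, h.symm⟩
    · exact Or.inr ⟨l, hl, h.symm⟩
  obtain ⟨w', hur, hloc⟩ := hw.exists_extension hfin w₀ hfin₀
  have hloc1 : ∀ g : G, ∃ g', w g = w g' ∧ w' g = w₀ g' := fun g => by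
    obtain ⟨g', hg'⟩ := hloc {1} g
    exact ⟨g', by simpa using hg'⟩
  have hext' : Extends w' w := fun g p hp => by
    obtain ⟨g', h1, h2⟩ := hloc1 g
    rw [h2]
    exact hext g' p (h1 ▸ hp)
  refine ⟨w', ?_, hur.comp Prod.snd, hext', ⟨(r + ρ) / 2, by linarith, fun hcon => hthin ?_⟩, ?_⟩
  · refine hfin₀.subset ?_
    rintro _ ⟨g, rfl⟩
    obtain ⟨g', -, h2⟩ := hloc1 g
    exact ⟨g', h2.symm⟩
  · have hB : Thin {g | w g = none ∧ w' g ≠ none} ((r - ρ) / 2) := by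
      refine ⟨E, ⟨1, h1E⟩, fun c => lt_of_le_of_lt ?_ hEL⟩
      obtain ⟨c', hc'⟩ := hloc E c
      refine le_trans (le_of_eq ?_) (Nat.cast_le.2 (hvis c'))
      norm_cast
      refine visits_congr fun e he => ?_
      simp only [Set.mem_ofPred_eq]
      rw [(hc' e he).1, (hc' e he).2]
    have h1 := (hcon.union hG hB).mono (J' := freeSites w) fun g hg => by
      by_cases h : w' g = none
      · exact Or.inl h
      · exact Or.inr ⟨hg, h⟩
    convert h1 using 1
    ring
  · have hFu : ∀ u : K → A, ∃ d : G,
        (∃ g : G, ∀ (k : K) (p : P), w (k * g) = some p → (u k : P) = p) →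
        ∀ k : K, (k : G) * d ∈ L ∧ z (k * d) = u k := fun u => by
      by_cases h : ∃ g : G, ∀ (k : K) (p : P), w (k * g) = some p → (u k : P) = p
      · obtain ⟨d, hd⟩ := hu u h
        exact ⟨d, fun _ => hd⟩
      · exact ⟨1, fun h' => absurd h' h⟩
    choose d hd using hFu
    refine ⟨Finset.univ.image d * F, fun u hu g => ?_⟩
    obtain ⟨g', hg'⟩ := hloc (K * (Finset.univ.image d * F)) g
    obtain ⟨f, hf, hfg⟩ := hF g'
    have hdf : d u * f ∈ Finset.univ.image d * F :=
      Finset.mul_mem_mul (Finset.mem_image_of_mem d (Finset.mem_univ u)) hf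
    refine ⟨d u * f, hdf, fun k => ?_⟩
    have h1 := (hg' _ (Finset.mul_mem_mul k.2 hdf)).2
    have h2 := hfg _ (hd u hu k).1
    rw [(hd u hu k).2] at h2
    rw [← h2]
    simpa only [mul_assoc] using h1

end Patterns

section FillShift

theorem mem_closure_pi_iff_forall_dist {I A : Type*} [PseudoMetricSpace A] {s : Set (I → A)}
    {x : I → A} :
    x ∈ closure s ↔ ∀ (K : Finset I) (ε : ℝ), 0 < ε → ∃ y ∈ s, ∀ k ∈ K, dist (y k) (x k) < ε := by
  constructor
  · intro h K ε hε
    obtain ⟨y, hy, hys⟩ := mem_closure_iff.1 h (⋂ k ∈ K, (fun y : I → A => y k) ⁻¹' Metric.ball (x k) ε)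
      (isOpen_biInter_finset fun k _ => Metric.isOpen_ball.preimage (continuous_apply k))
      (by simp [hε])
    exact ⟨y, hys, by simpa using hy⟩
  · intro h
    rw [mem_closure_iff]
    intro o ho hx
    obtain ⟨K, u, hu, hsub⟩ := isOpen_pi_iff.1 ho x hx
    have h1 : ∀ᶠ ε in 𝓝[>] (0 : ℝ), ∀ k ∈ K, Metric.ball (x k) ε ⊆ u k := by
      rw [Filter.eventually_all_finset]
      intro k hk
      obtain ⟨ε, hε, hsub⟩ := Metric.isOpen_iff.1 (hu k hk).1 _ (hu k hk).2
      filter_upwards [Ioo_mem_nhdsGT hε] with δ hδ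
      exact (Metric.ball_subset_ball hδ.2.le).trans hsub
    obtain ⟨ε, hε, hε0⟩ := (h1.and self_mem_nhdsWithin).exists
    obtain ⟨y, hy, hyx⟩ := h K ε hε0
    exact ⟨y, hsub fun i hi => hε i hi (hyx i hi), hy⟩

variable {G P : Type*}

/-- The configurations completing `w`. -/
def fillings (w : G → Option P) : Set (G → P) := {z | ∀ g p, w g = some p → z g = p}

theorem fillings_anti {w w' : G → Option P} (h : Extends w' w) : fillings w' ⊆ fillings w :=
  fun _ hz g p hp => hz g p (h g p hp)

theorem fillings_nonempty [Nonempty P] (w : G → Option P) : (fillings w).Nonempty :=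
  ⟨fun g => (w g).getD (Classical.arbitrary P), fun g p hp => by simp [hp]⟩

variable [Group G]

/-- A finite-valued uniformly recurrent partial configuration with free sites of upper density more
than `ρ`. -/
structure IsStage (ρ : ℝ) (w : G → Option P) : Prop where
  finite_range : (Set.range w).Finite
  recurrent : IsUniformlyRecurrent w
  not_thin : ∃ r > ρ, ¬ Thin (freeSites w) r

theorem isStage_none {ρ : ℝ} (hρ : ρ < 1) : IsStage ρ (fun _ : G => (none : Option P)) where
  finite_range := (Set.finite_singleton none).subset (by rintro _ ⟨g, rfl⟩; rfl)
  recurrent := fun _ => ⟨{1}, fun _ => ⟨1, by simp⟩⟩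
  not_thin := ⟨1, hρ, by
    have : freeSites (fun _ : G => (none : Option P)) = Set.univ := by ext; simp [freeSites]
    rw [this]
    exact not_thin_univ⟩

variable [MetricSpace P]

/-- The subshift generated by the completions of `w`. -/
def fillShift (w : G → Option P) : Set (G → P) := closure (⋃ c : G, shiftAct c '' fillings w)

theorem fillShift_anti {w w' : G → Option P} (h : Extends w' w) : fillShift w' ⊆ fillShift w :=
  closure_mono (Set.iUnion_mono fun _ => Set.image_mono (fillings_anti h))

theorem fillShift_nonempty [Nonempty P] (w : G → Option P) : (fillShift w).Nonempty := by
  obtain ⟨z, hz⟩ := fillings_nonempty w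
  exact ⟨_, subset_closure (Set.mem_iUnion.2 ⟨1, z, hz, rfl⟩)⟩

theorem shiftAct_mem_fillShift {w : G → Option P} (c : G) {x : G → P} (hx : x ∈ fillShift w) :
    shiftAct c x ∈ fillShift w := by
  refine map_mem_closure (continuous_shiftAct c) hx ?_
  intro y hy
  obtain ⟨d, z, hz, rfl⟩ := Set.mem_iUnion.1 hy
  exact Set.mem_iUnion.2 ⟨c * d, z, hz, (shiftAct_shiftAct c d z).symm⟩

theorem exists_fillings_dist_lt {w : G → Option P} {x : G → P} (hx : x ∈ fillShift w)
    (K : Finset G) {ε : ℝ} (hε : 0 < ε) :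
    ∃ z ∈ fillings w, ∃ c, ∀ k ∈ K, dist (z (k * c)) (x k) < ε := by
  obtain ⟨y, hy, h⟩ := mem_closure_pi_iff_forall_dist.1 hx K ε hε
  obtain ⟨c, z, hz, rfl⟩ := Set.mem_iUnion.1 hy
  exact ⟨z, hz, c, h⟩

/-- Up to a shift, points of `fillShift w` agree with `w` on any finite window. -/
theorem exists_shift_agree {w : G → Option P} (hfin : (Set.range w).Finite) {x : G → P}
    (hx : x ∈ fillShift w) (F : Finset G) :
    ∃ c, ∀ g ∈ F, ∀ p, w (g * c) = some p → x g = p := by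
  classical
  have : Finite (Set.range w) := hfin
  let pat : G → F → Set.range w := fun c g => ⟨w (g * c), _, rfl⟩
  have hcl : IsClosed (⋃ q ∈ Set.range pat,
      {x : G → P | ∀ (g : F) (p : P), (q g : Option P) = some p → x g = p}) := by
    refine (Set.toFinite _).isClosed_biUnion fun q _ => ?_
    simp only [Set.ofPred_forall]
    exact isClosed_iInter fun g => isClosed_iInter fun p => isClosed_iInter fun _ =>
      isClosed_eq (continuous_apply _) continuous_const
  have hsub : fillShift w ⊆ _ := closure_minimal (fun y hy => ?_) hcl
  · obtain ⟨_, ⟨c, rfl⟩, hc⟩ := Set.mem_iUnion₂.1 (hsub hx)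
    exact ⟨c, fun g hg p hp => hc ⟨g, hg⟩ p hp⟩
  · obtain ⟨c, z, hz, rfl⟩ := Set.mem_iUnion.1 hy
    exact Set.mem_iUnion₂.2 ⟨pat c, ⟨c, rfl⟩, fun g p hp => hz _ p hp⟩

theorem IsStage.exists_next [Countable G] [Infinite G] [Nonempty P] [CompactSpace P]
    (hG : IsAmenable G) {ρ : ℝ} (hρ : 0 < ρ) {w : G → Option P} (hw : IsStage ρ w) (K : Finset G)
    {ε : ℝ} (hε : 0 < ε) :
    ∃ w' : G → Option P, IsStage ρ w' ∧ Extends w' w ∧ Thin (freeSites w') (ρ + ε) ∧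
      ∀ y ∈ fillShift w, ∀ x ∈ fillShift w', ∃ c : G, ∀ k ∈ K, dist (x (k * c)) (y k) < ε := by
  classical
  obtain ⟨r, hr, hthin⟩ := hw.not_thin
  obtain ⟨t, -, htfin, htcov⟩ := Metric.totallyBounded_iff.1
    (isCompact_univ (X := P)).totallyBounded (ε / 3) (by positivity) |>.imp
    fun t ht => (⟨trivial, ht.1, ht.2⟩ : True ∧ _ ∧ _)
  have hval : ({p | some p ∈ Set.range w} : Set P).Finite :=
    hw.finite_range.preimage (Option.some_injective P).injOn
  let A : Finset P := (htfin.union hval).toFinset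
  obtain ⟨w₁, hfin₁, hur₁, hext₁, ⟨r₁, hr₁, hthin₁⟩, F, hF⟩ :=
    exists_extends_patterns hG hw.finite_range hw.recurrent hr hthin K A
  obtain ⟨w₂, hfin₂, hur₂, hext₂, hnt, ht⟩ :=
    exists_extends_thin hG hfin₁ hur₁ hρ hr₁ hthin₁ hε
  refine ⟨w₂, ⟨hfin₂, hur₂, hnt⟩, hext₂.trans hext₁, ht, fun y hy x hx => ?_⟩
  obtain ⟨z, hz, c, hc⟩ := exists_fillings_dist_lt hy K (show 0 < ε / 3 by positivity)
  have happrox : ∀ k : K, ∃ a : A, dist (a : P) (z (k * c)) < ε / 3 ∧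
      ∀ p, w (k * c) = some p → (a : P) = p := by
    intro k
    rcases h : w (k * c) with - | p
    · obtain ⟨a, ha, hza⟩ := Set.mem_iUnion₂.1 (htcov (Set.mem_univ (z (k * c))))
      exact ⟨⟨a, by simp [A, ha]⟩, by rw [dist_comm]; exact hza, by simp⟩
    · refine ⟨⟨p, ?_⟩, ?_, by simp⟩
      · simp only [A, Set.Finite.mem_toFinset]
        exact Or.inr ⟨_, h⟩
      · rw [hz _ p h, dist_self]; positivity
  choose u hu huw using happrox
  obtain ⟨z', hz', d, hd⟩ := exists_fillings_dist_lt hx (K * F) (show 0 < ε / 3 by positivity)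
  obtain ⟨f, hf, hfu⟩ := hF u ⟨c, huw⟩ d
  refine ⟨f, fun k hk => ?_⟩
  have h1 := hd _ (Finset.mul_mem_mul hk hf)
  have h2 : z' (k * f * d) = u ⟨k, hk⟩ := hz' _ _ (hext₂ _ _ (by
    rw [mul_assoc]; exact hfu ⟨k, hk⟩))
  rw [h2, dist_comm] at h1
  have h3 := dist_triangle4 (x (k * f)) (u ⟨k, hk⟩ : P) (z (k * c)) (y k)
  linarith [hu ⟨k, hk⟩, hc k hk]

/-- The subshift underlying the main theorem, described by its free and its frozen coordinates. -/
theorem exists_minimal_subshift_freedom [Countable G] [Infinite G] [Nonempty P] [CompactSpace P]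
    (hG : IsAmenable G) {ρ : ℝ} (hρ0 : 0 < ρ) (hρ1 : ρ < 1) :
    ∃ X : Set (G → P), X.Nonempty ∧ IsClosed X ∧ (∀ c : G, shiftAct c '' X = X) ∧
      (∀ y ∈ X, X ⊆ closure (Set.range fun c : G => shiftAct c y)) ∧
      (∀ F : Finset G, F.Nonempty → ∃ S ⊆ F, ρ * F.card ≤ S.card ∧
        ∃ b : G → P, ∀ x : G → P, (∀ g ∉ S, x g = b g) → x ∈ X) ∧
      ∀ δ > 0, ∃ (A : Set P) (J : Set G), A.Finite ∧
        (∀ x ∈ X, ∀ F : Finset G, ∃ c, ∀ g ∈ F, g * c ∉ J → x g ∈ A) ∧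
        ∃ M : Finset G, M.Nonempty ∧ ∀ c, (visits J M c : ℝ) ≤ (ρ + δ) * M.card := by
  classical
  obtain ⟨e, he⟩ := exists_surjective_nat G
  let K : ℕ → Finset G := fun n => (Finset.range n).image e
  have hK : ∀ F : Finset G, ∀ᶠ n in atTop, F ⊆ K n := by
    intro F
    have : ∀ᶠ n in atTop, ∀ g ∈ F, g ∈ K n := by
      rw [Filter.eventually_all_finset]
      intro g _
      obtain ⟨i, rfl⟩ := he g
      filter_upwards [eventually_gt_atTop i] with n hn
      exact Finset.mem_image_of_mem e (Finset.mem_range.2 hn)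
    exact this
  let ε : ℕ → ℝ := fun n => 1 / ((n : ℝ) + 1)
  have hε : ∀ n, 0 < ε n := fun n => by positivity
  have hε0 : ∀ δ > 0, ∀ᶠ n in atTop, ε n < δ := fun δ hδ =>
    tendsto_one_div_add_atTop_nhds_zero_nat.eventually_lt_const hδ
  choose next hstage hext hthin hnear using
    fun (n : ℕ) (w : {w : G → Option P // IsStage ρ w}) =>
      w.2.exists_next hG hρ0 (K n) (hε n)
  let W : ℕ → {w : G → Option P // IsStage ρ w} := fun n =>
    n.rec ⟨_, isStage_none hρ1⟩ fun n w => ⟨next n w, hstage n w⟩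
  have hWext : ∀ n, Extends (W (n + 1)).1 (W n).1 := fun n => hext n (W n)
  have hanti : Antitone fun n => fillShift (W n).1 :=
    antitone_nat_of_succ_le fun n => fillShift_anti (hWext n)
  have hcl : ∀ n, IsClosed (fillShift (W n).1) := fun n => isClosed_closure
  let X := ⋂ n, fillShift (W n).1
  have hinv : ∀ c : G, ∀ x ∈ X, shiftAct c x ∈ X := fun c x hx =>
    Set.mem_iInter.2 fun n => shiftAct_mem_fillShift c (Set.mem_iInter.1 hx n)
  refine ⟨X, ?_, isClosed_iInter hcl, fun c => ?_, fun y hy x hx => ?_, fun F hF => ?_,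
    fun δ hδ => ?_⟩
  · exact IsCompact.nonempty_iInter_of_directed_nonempty_isCompact_isClosed _
      hanti.directed_ge (fun n => fillShift_nonempty _) (fun n => (hcl n).isCompact) hcl
  · refine Set.Subset.antisymm ?_ fun x hx => ⟨shiftAct c⁻¹ x, hinv _ _ hx, ?_⟩
    · rintro _ ⟨x, hx, rfl⟩
      exact hinv c x hx
    · rw [shiftAct_shiftAct, mul_inv_cancel, shiftAct_one]
  · refine mem_closure_pi_iff_forall_dist.2 fun F δ hδ => ?_
    obtain ⟨n, h1, h2⟩ := ((hK F).and (hε0 δ hδ)).exists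
    obtain ⟨c, hc⟩ := hnear n (W n) x (Set.mem_iInter.1 hx n) y (Set.mem_iInter.1 hy (n + 1))
    exact ⟨_, ⟨c, rfl⟩, fun k hk => (hc k (h1 hk)).trans h2⟩
  · let T : Finset G → ℕ → Set (G → P) := fun S n =>
      {b | ∀ x : G → P, (∀ g ∉ S, x g = b g) → x ∈ fillShift (W n).1}
    have hTanti : ∀ S, Antitone (T S) := fun S m n hmn b hb x hx => hanti hmn (hb x hx)
    have hTcl : ∀ S n, IsClosed (T S n) := by
      intro S n
      have : T S n = ⋂ a : G → P, (fun b g => if g ∈ S then a g else b g) ⁻¹' fillShift (W n).1 := by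
        ext b
        simp only [T, Set.mem_ofPred_eq, Set.mem_iInter, Set.mem_preimage]
        constructor
        · exact fun h a => h _ fun g hg => if_neg hg
        · intro h x hx
          convert h x using 1
          funext g
          split_ifs with hg
          · rfl
          · exact hx g hg
      rw [this]
      refine isClosed_iInter fun a => (hcl n).preimage (continuous_pi fun g => ?_)
      split_ifs
      · exact continuous_const
      · exact continuous_apply g
    have hTne : ∀ n, ∃ S ⊆ F, ρ * F.card ≤ S.card ∧ (T S n).Nonempty := by
      intro n
      obtain ⟨r, hr, hnt⟩ := (W n).2.not_thin
      obtain ⟨c, hc⟩ : ∃ c, r * F.card ≤ visits (freeSites (W n).1) F c := by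
        by_contra! hcon
        exact hnt ⟨F, hF, hcon⟩
      obtain ⟨z, hz⟩ := fillings_nonempty (W n).1
      refine ⟨F.filter fun f => f * c ∈ freeSites (W n).1, Finset.filter_subset _ _, ?_,
        shiftAct c z, fun x hx => ?_⟩
      · refine le_trans ?_ (hc.trans (le_of_eq ?_))
        · gcongr
        · norm_cast
      · refine subset_closure (Set.mem_iUnion.2 ⟨c, shiftAct c⁻¹ x, fun g p hp => ?_, ?_⟩)
        · simp only [shiftAct]
          rw [hx]
          · simpa [shiftAct] using hz g p hp
          · intro hmem
            simpa [freeSites, hp] using (Finset.mem_filter.1 hmem).2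
        · rw [shiftAct_shiftAct, mul_inv_cancel, shiftAct_one]
    obtain ⟨S, hSF, hScard, hS⟩ : ∃ S ⊆ F, ρ * F.card ≤ S.card ∧ ∀ n, (T S n).Nonempty := by
      by_contra! hcon
      have : ∀ S : Finset G, ∃ n, S ⊆ F → ρ * F.card ≤ S.card → T S n = ∅ := by
        intro S
        by_cases h : S ⊆ F ∧ ρ * F.card ≤ S.card
        · obtain ⟨n, hn⟩ := hcon S h.1 h.2
          exact ⟨n, fun _ _ => hn⟩
        · exact ⟨0, fun h1 h2 => absurd ⟨h1, h2⟩ h⟩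
      choose n hn using this
      obtain ⟨S, hSF, hS, hne⟩ := hTne (F.powerset.sup n)
      have h1 := hTanti S (Finset.le_sup (f := n) (Finset.mem_powerset.2 hSF))
      have h2 := hne.mono h1
      rw [hn S hSF hS] at h2
      exact Set.not_nonempty_empty h2
    obtain ⟨b, hb⟩ := IsCompact.nonempty_iInter_of_directed_nonempty_isCompact_isClosed (T S)
      (hTanti S).directed_ge hS (fun n => (hTcl S n).isCompact) (hTcl S)
    exact ⟨S, hSF, hScard, b, fun x hx => Set.mem_iInter.2 fun n => Set.mem_iInter.1 hb n x hx⟩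
  · obtain ⟨n, hn⟩ := (hε0 δ hδ).exists
    obtain ⟨M, hM, hMv⟩ : Thin (freeSites (W (n + 1)).1) (ρ + ε n) := hthin n (W n)
    refine ⟨{p | some p ∈ Set.range (W (n + 1)).1}, freeSites (W (n + 1)).1,
      (W (n + 1)).2.finite_range.preimage (Option.some_injective P).injOn, fun x hx F => ?_,
      M, hM, fun c => (hMv c).le.trans ?_⟩
    · obtain ⟨c, hc⟩ := exists_shift_agree (W (n + 1)).2.finite_range
        (Set.mem_iInter.1 hx (n + 1)) F
      refine ⟨c, fun g hg hgJ => ?_⟩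
      obtain ⟨p, hp⟩ := Option.ne_none_iff_exists'.1 hgJ
      rw [hc g hg p hp]
      exact ⟨_, hp⟩
    · gcongr

end FillShift

section CoveringOrder

variable {Y : Type*}

section FCover

variable {H : Type*} {σ : H → Y → Y} {F : Finset H} {α : Finset (Set Y)}

theorem exists_of_mem_FCover {U : Set Y} (hU : U ∈ FCover σ F α) :
    ∃ f : H → Set Y, (∀ g ∈ F, f g ∈ α) ∧ U = ⋂ g ∈ F, σ g ⁻¹' f g := by
  classical
  obtain ⟨f, hf, rfl⟩ := Finset.mem_image.1 hU
  rw [Finset.mem_pi] at hf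
  refine ⟨fun g => if h : g ∈ F then f g h else ∅, fun g hg => by simp [hg, hf], ?_⟩
  refine Set.iInter₂_congr fun g hg => ?_
  simp [hg]

theorem biInter_preimage_mem_FCover {f : H → Set Y} (hf : ∀ g ∈ F, f g ∈ α) :
    ⋂ g ∈ F, σ g ⁻¹' f g ∈ FCover σ F α := by
  classical
  exact Finset.mem_image.2 ⟨fun g _ => f g, Finset.mem_pi.2 hf, rfl⟩

end FCover

theorem ncard_le_ordOn_add_one {X : Set Y} (β : Finset (Set Y)) {y : Y} (hy : y ∈ X) :
    {U : Set Y | U ∈ β ∧ y ∈ U}.ncard ≤ ordOn X β + 1 := by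
  have hbdd : BddAbove (Set.range fun y : X => {U : Set Y | U ∈ β ∧ (y : Y) ∈ U}.ncard - 1) := by
    refine ⟨β.card, ?_⟩
    rintro _ ⟨y, rfl⟩
    refine (Nat.sub_le _ _).trans ?_
    rw [← Set.ncard_coe_finset]
    exact Set.ncard_le_ncard (fun U hU => hU.1) β.finite_toSet
  have h : {U : Set Y | U ∈ β ∧ y ∈ U}.ncard - 1 ≤ ordOn X β := le_ciSup hbdd ⟨y, hy⟩
  omega

variable [TopologicalSpace Y]

theorem Dcov_le {X : Set Y} {α β : Finset (Set Y)} (hβ : IsOpenCoverOf X β)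
    (h : ∀ U ∈ β, ∃ V ∈ α, U ⊆ V) : Dcov X α ≤ ordOn X β :=
  Nat.sInf_le ⟨β, hβ, h, rfl⟩

theorem IsOpenCoverOf.exists_ordOn_eq_Dcov {X : Set Y} {α : Finset (Set Y)}
    (hα : IsOpenCoverOf X α) :
    ∃ β : Finset (Set Y), IsOpenCoverOf X β ∧ (∀ U ∈ β, ∃ V ∈ α, U ⊆ V) ∧
      ordOn X β = Dcov X α :=
  Nat.sInf_mem (s := {n | ∃ β : Finset (Set Y), IsOpenCoverOf X β ∧
    (∀ U ∈ β, ∃ V ∈ α, U ⊆ V) ∧ ordOn X β = n}) ⟨_, α, hα, fun U hU => ⟨U, hU, subset_rfl⟩, rfl⟩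

theorem IsOpenCoverOf.fCover {H : Type*} {σ : H → Y → Y} {F : Finset H} {α : Finset (Set Y)}
    {X : Set Y} (hα : IsOpenCoverOf X α) (hσ : ∀ g, Continuous (σ g))
    (hX : ∀ g, Set.MapsTo (σ g) X X) : IsOpenCoverOf X (FCover σ F α) := by
  refine ⟨fun U hU => ?_, fun x hx => ?_⟩
  · obtain ⟨f, hf, rfl⟩ := exists_of_mem_FCover hU
    exact isOpen_biInter_finset fun g hg => (hα.1 _ (hf g hg)).preimage (hσ g)
  · choose f hf hxf using fun g => Set.mem_iUnion₂.1 (hα.2 (hX g hx))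
    exact Set.mem_iUnion₂.2 ⟨_, biInter_preimage_mem_FCover fun g _ => hf g,
      Set.mem_iInter₂.2 fun g _ => hxf g⟩

/-- A cover separating opposite faces of a cube in `X` has order at least the dimension of the
cube. -/
theorem card_le_Dcov {ι : Type*} [Fintype ι] {X : Set Y} {α : Finset (Set Y)}
    (hα : IsOpenCoverOf X α) {φ : (ι → ℝ) → Y} (hφ : Continuous φ)
    (hφX : Set.MapsTo φ (Set.Icc 0 1) X)
    (hface : ∀ V ∈ α, ∀ i, ∀ x ∈ Set.Icc (0 : ι → ℝ) 1, ∀ x' ∈ Set.Icc (0 : ι → ℝ) 1,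
      φ x ∈ V → φ x' ∈ V → x i = 0 → x' i ≠ 1) :
    Fintype.card ι ≤ Dcov X α := by
  obtain ⟨β, hβ, hβα, hord⟩ := hα.exists_ordOn_eq_Dcov
  obtain ⟨x, hx, t, ht, hxt⟩ := exists_mem_of_open_cover_cube (fun U : β => φ ⁻¹' (U : Set Y))
    (fun U => (hβ.1 _ U.2).preimage hφ)
    (fun x hx => by
      obtain ⟨U, hU, hxU⟩ := Set.mem_iUnion₂.1 (hβ.2 (hφX hx))
      exact Set.mem_iUnion.2 ⟨⟨U, hU⟩, hxU⟩)
    (fun U i x hx x' hx' h0 => by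
      obtain ⟨V, hV, hUV⟩ := hβα _ U.2
      exact hface V hV i x hx.2 x' hx'.2 (hUV hx.1) (hUV hx'.1) h0)
  have h1 : t.card ≤ {U : Set Y | U ∈ β ∧ φ x ∈ U}.ncard := by
    rw [← Finset.card_map (Function.Embedding.subtype _), ← Set.ncard_coe_finset]
    refine Set.ncard_le_ncard (fun U hU => ?_) (β.finite_toSet.subset fun U hU => hU.1)
    obtain ⟨c, hc, rfl⟩ := Finset.mem_map.1 (Finset.mem_coe.1 hU)
    exact ⟨c.2, hxt c hc⟩
  have h2 := ncard_le_ordOn_add_one β (hφX hx)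
  omega

/-- An open cover separating opposite faces of an embedded cube. -/
theorem exists_finset_separating_faces [T2Space Y] {ι : Type*} [Fintype ι] {ψ : (ι → ℝ) → Y}
    (hψ : Continuous ψ)
    (hface : ∀ i, ∀ x ∈ Set.Icc (0 : ι → ℝ) 1, ∀ x' ∈ Set.Icc (0 : ι → ℝ) 1,
      ψ x = ψ x' → x i = 0 → x' i ≠ 1) :
    ∃ α : Finset (Set Y), (∀ V ∈ α, IsOpen V) ∧ (∀ y, ∃ V ∈ α, y ∈ V) ∧
      ∀ V ∈ α, ∀ i, ∀ x ∈ Set.Icc (0 : ι → ℝ) 1, ∀ x' ∈ Set.Icc (0 : ι → ℝ) 1,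
        ψ x ∈ V → ψ x' ∈ V → x i = 0 → x' i ≠ 1 := by
  classical
  let A : Bool → ι → Set Y := fun b i => ψ '' (Set.Icc 0 1 ∩ {x | x i = if b then 1 else 0})
  have hA : ∀ b i, IsClosed (A b i) := fun b i =>
    ((isCompact_Icc.inter_right (isClosed_eq (continuous_apply i) continuous_const)).image
      hψ).isClosed
  refine ⟨(Finset.univ : Finset (ι → Bool)).image fun T => ⋂ i, (A (T i) i)ᶜ, ?_, fun y => ?_, ?_⟩
  · simp only [Finset.mem_image, Finset.mem_univ, true_and, forall_exists_index]
    rintro _ T rfl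
    exact isOpen_iInter_of_finite fun i => (hA _ i).isOpen_compl
  · have : ∀ i, ∃ b, y ∉ A b i := by
      intro i
      by_contra! h
      obtain ⟨x, ⟨hx, hx0⟩, hxy⟩ := h false
      obtain ⟨x', ⟨hx', hx1⟩, hxy'⟩ := h true
      exact hface i x hx x' hx' (hxy.trans hxy'.symm) (by simpa using hx0) (by simpa using hx1)
    choose T hT using this
    exact ⟨_, Finset.mem_image_of_mem _ (Finset.mem_univ T), Set.mem_iInter.2 hT⟩
  · simp only [Finset.mem_image, Finset.mem_univ, true_and, forall_exists_index]
    rintro _ T rfl i x hx x' hx' hxT hxT' h0 h1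
    rw [Set.mem_iInter] at hxT hxT'
    rcases h : T i with - | -
    · exact hxT i (by rw [h]; exact ⟨x, ⟨hx, by simpa using h0⟩, rfl⟩)
    · exact hxT' i (by rw [h]; exact ⟨x', ⟨hx', by simpa using h1⟩, rfl⟩)

open Classical in
/-- A cover coarser than the unit boxes of finitely many functions has order at most the maximal
number of them that are simultaneously integral. -/
theorem Dcov_le_of_card_integral_le {ι : Type*} [Fintype ι] {X : Set Y} (hX : IsCompact X)
    {α : Finset (Set Y)} (f : ι → Y → ℝ) (hf : ∀ i, Continuous (f i)) {k : ℕ}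
    (hk : ∀ x ∈ X, (Finset.univ.filter fun i => ∃ z : ℤ, f i x = z).card ≤ k)
    (hα : ∀ x ∈ X, ∃ V ∈ α, ∀ y, (∀ i, |f i x - f i y| < 1) → y ∈ V) :
    Dcov X α ≤ k := by
  obtain ⟨β, hβ, hord, hsmall⟩ := exists_openCover_ordOn_le hX f hf k hk
  refine (Dcov_le hβ fun U hU => ?_).trans hord
  obtain ⟨⟨x, hxU, hxX⟩, h⟩ := hsmall U hU
  obtain ⟨V, hV, hxV⟩ := hα x hxX
  exact ⟨V, hV, fun y hy => hxV y (h x hxU y hy)⟩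

/-- Lebesgue number lemma in a space whose topology is induced by real functions. -/
theorem Topology.IsInducing.exists_lebesgue_number {ι : Type*} {f : ι → Y → ℝ}
    (hf : IsInducing fun y i => f i y) {X : Set Y} (hX : IsCompact X) {α : Finset (Set Y)}
    (hα : IsOpenCoverOf X α) :
    ∃ (K : Finset ι) (ε : ℝ), 0 < ε ∧
      ∀ x ∈ X, ∃ V ∈ α, ∀ y, (∀ i ∈ K, |f i x - f i y| < ε) → y ∈ V := by
  choose W hW hWV using fun V : α => hf.isOpen_iff.1 (hα.1 _ V.2)
  obtain ⟨n, hn, hball⟩ := lebesgue_number_lemma (hX.image hf.continuous) hW (by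
    rintro _ ⟨x, hx, rfl⟩
    obtain ⟨V, hV, hxV⟩ := Set.mem_iUnion₂.1 (hα.2 hx)
    refine Set.mem_iUnion.2 ⟨⟨V, hV⟩, ?_⟩
    rwa [← Set.mem_preimage (f := fun y i => f i y), hWV])
  rw [Pi.uniformity] at hn
  obtain ⟨K, hK, u, hu, -, rfl, -⟩ := Filter.mem_iInf'.1 hn
  lift K to Finset ι using hK
  have h1 : ∀ᶠ ε in 𝓝[>] (0 : ℝ), ∀ i ∈ K, ∀ y y' : ι → ℝ, |y i - y' i| < ε → (y, y') ∈ u i := by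
    rw [Filter.eventually_all_finset]
    intro i hi
    obtain ⟨v, hv, hvu⟩ := Filter.mem_comap.1 (hu i)
    obtain ⟨ε, hε, hsub⟩ := Metric.mem_uniformity_dist.1 hv
    filter_upwards [Ioo_mem_nhdsGT hε] with δ hδ y y' hy
    exact hvu (hsub (by rw [Real.dist_eq]; exact hy.trans hδ.2))
  obtain ⟨ε, hε, hε0⟩ := (h1.and self_mem_nhdsWithin).exists
  refine ⟨K, ε, hε0, fun x hx => ?_⟩
  obtain ⟨V, hV⟩ := hball _ ⟨x, hx, rfl⟩
  refine ⟨V, V.2, fun y hy => ?_⟩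
  rw [← hWV V]
  exact hV (Set.mem_iInter₂.2 fun i hi => hε i hi _ _ (hy i hi))

end CoveringOrder

section Polyhedron

theorem exists_cube_convexHull.{u} {E : Type u} [NormedAddCommGroup E] [NormedSpace ℝ E] {s : Set E}
    (hs : s.Nonempty) (hfin : s.Finite) :
    ∃ (ι : Type u) (_ : Fintype ι) (ψ : (ι → ℝ) → E), Continuous ψ ∧
      Fintype.card ι = Module.finrank ℝ (vectorSpan ℝ s) ∧ (∀ a, ψ a ∈ convexHull ℝ s) ∧
      ∀ i, ∀ x ∈ Set.Icc (0 : ι → ℝ) 1, ∀ x' ∈ Set.Icc (0 : ι → ℝ) 1,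
        ψ x = ψ x' → x i = 0 → x' i ≠ 1 := by
  classical
  obtain ⟨t, hts, hspan, ht⟩ := exists_affineIndependent ℝ E s
  have htne : t.Nonempty := by
    rw [← affineSpan_nonempty ℝ, hspan, affineSpan_nonempty]
    exact hs
  obtain ⟨p, hp⟩ := htne
  have : Fintype t := (hfin.subset hts).fintype
  rw [affineIndependent_iff_linearIndependent_vsub ℝ _ (⟨p, hp⟩ : t)] at ht
  let ι := {x : t // x ≠ ⟨p, hp⟩}
  let w : (ι → ℝ) → ι → ℝ := fun a i => max 0 (min 1 (a i)) / Fintype.card ι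
  have hw0 : ∀ a i, 0 ≤ w a i := fun a i => by positivity
  have hw1 : ∀ a, ∑ i, w a i ≤ 1 := by
    intro a
    calc ∑ i, w a i ≤ ∑ i : ι, 1 / (Fintype.card ι : ℝ) := by
          exact Finset.sum_le_sum fun i _ => div_le_div_of_nonneg_right
            (max_le zero_le_one (min_le_left _ _)) (Nat.cast_nonneg _)
      _ ≤ 1 := by
          simp only [Finset.sum_const, Finset.card_univ, nsmul_eq_mul]
          rw [mul_one_div]
          exact div_self_le_one _
  refine ⟨ι, inferInstance, fun a => p + ∑ i : ι, w a i • (((i : t) : E) - p), ?_, ?_, fun a => ?_, ?_⟩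
  · simp only [w]
    fun_prop
  · have h1 : vectorSpan ℝ s = vectorSpan ℝ t := by
      rw [← direction_affineSpan, ← hspan, direction_affineSpan]
    have h2 : Submodule.span ℝ (Set.range fun i : ι => (((i : t) : E) -ᵥ p)) = vectorSpan ℝ t := by
      have := vectorSpan_range_eq_span_range_vsub_right_ne ℝ (fun x : t => (x : E)) ⟨p, hp⟩
      rw [Subtype.range_coe] at this
      exact this.symm
    rw [h1, ← h2, finrank_span_eq_card ht]
  · have h := (convex_convexHull ℝ s).sum_mem (t := (Finset.univ : Finset (Option ι)))
      (w := fun o => o.elim (1 - ∑ i, w a i) (w a)) (z := fun o => o.elim p fun i => ((i : t) : E))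
      (by rintro (- | i) - <;> simp [hw0, hw1]) (by simp [Fintype.sum_option])
      (by rintro (- | i) - <;> [exact subset_convexHull ℝ _ (hts hp);
        exact subset_convexHull ℝ _ (hts i.1.2)])
    convert h using 1
    simp only [Fintype.sum_option, Option.elim, smul_sub, Finset.sum_sub_distrib, sub_smul, one_smul,
      ← Finset.sum_smul]
    abel
  · intro i x hx x' hx' heq h0 h1
    have h2 : ∑ i : ι, (w x i - w x' i) • (((i : t) : E) - p) = 0 := by
      simp only [sub_smul, Finset.sum_sub_distrib, sub_eq_zero]
      exact add_left_cancel heq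
    have h3 := Fintype.linearIndependent_iff.1 ht _ h2 i
    have : Nonempty ι := ⟨i⟩
    have h4 : (Fintype.card ι : ℝ) ≠ 0 := by exact_mod_cast Fintype.card_ne_zero
    simp [w, h0, h1, h4] at h3

variable {N : ℕ}

open Classical in
theorem exists_offset (S : Finset (Finset (EuclideanSpace ℝ (Fin N)))) {m : ℕ}
    (hS : ∀ s ∈ S, Module.finrank ℝ (vectorSpan ℝ (s : Set (EuclideanSpace ℝ (Fin N)))) ≤ m)
    {A : Set (EuclideanSpace ℝ (Fin N))} (hA : A.Finite) {η : ℝ} (hη : η ≠ 0) :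
    ∃ θ : Fin N → ℝ,
      (∀ x ∈ ⋃ s ∈ S, convexHull ℝ (s : Set (EuclideanSpace ℝ (Fin N))),
        (Finset.univ.filter fun j => ∃ z : ℤ, (x j - θ j) / η = z).card ≤ m) ∧
      ∀ x ∈ A, ∀ j, ¬ ∃ z : ℤ, (x j - θ j) / η = z := by
  obtain ⟨θ, hθ⟩ := exists_generic_offset (S ∪ hA.toFinset.image fun a => {a}) hη
  refine ⟨θ, fun x hx => ?_, fun x hx j hj => ?_⟩
  · obtain ⟨s, hs, hxs⟩ := Set.mem_iUnion₂.1 hx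
    exact (hθ s (Finset.mem_union_left _ hs) x hxs).trans (hS s hs)
  · have h := hθ {x} (Finset.mem_union_right _ (Finset.mem_image_of_mem _ (by simpa using hx))) x
      (by simp)
    rw [Finset.coe_singleton, vectorSpan_singleton, finrank_bot, Nat.le_zero,
      Finset.card_eq_zero] at h
    exact Finset.filter_eq_empty_iff.1 h (Finset.mem_univ j) hj

theorem isCompact_biUnion_convexHull (S : Finset (Finset (EuclideanSpace ℝ (Fin N)))) :
    IsCompact (⋃ s ∈ S, convexHull ℝ (s : Set (EuclideanSpace ℝ (Fin N)))) :=
  S.isCompact_biUnion fun s _ => s.finite_toSet.isCompact_convexHull ℝ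

/-- The dimension of a polyhedron is the largest dimension of its simplices. -/
theorem topDim_biUnion_convexHull (S : Finset (Finset (EuclideanSpace ℝ (Fin N))))
    {s₀ : Finset (EuclideanSpace ℝ (Fin N))} (hs₀ : s₀ ∈ S) (hne : s₀.Nonempty)
    (hmax : ∀ s ∈ S, Module.finrank ℝ (vectorSpan ℝ (s : Set (EuclideanSpace ℝ (Fin N)))) ≤
      Module.finrank ℝ (vectorSpan ℝ (s₀ : Set (EuclideanSpace ℝ (Fin N))))) :
    topDim (⋃ s ∈ S, convexHull ℝ (s : Set (EuclideanSpace ℝ (Fin N)))) =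
      Module.finrank ℝ (vectorSpan ℝ (s₀ : Set (EuclideanSpace ℝ (Fin N)))) := by
  classical
  apply le_antisymm
  · refine iSup₂_le fun α hα => ?_
    obtain ⟨K, ε, hε, hK⟩ := (EuclideanSpace.equiv (Fin N) ℝ).toHomeomorph.isInducing.exists_lebesgue_number
      (f := fun j x => x j) (isCompact_biUnion_convexHull S) hα
    obtain ⟨θ, hθ, -⟩ := exists_offset S hmax Set.finite_empty hε.ne'
    have := Dcov_le_of_card_integral_le (isCompact_biUnion_convexHull S) (α := α)
      (fun j x => (x j - θ j) / ε) (fun j => by fun_prop) hθ (fun x hx => by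
        obtain ⟨V, hV, h⟩ := hK x hx
        refine ⟨V, hV, fun y hy => h y fun j _ => ?_⟩
        have := hy j
        rwa [← sub_div, sub_sub_sub_cancel_right, abs_div, abs_of_pos hε, div_lt_one hε] at this)
    exact_mod_cast this
  · obtain ⟨ι, _, ψ, hψ, hcard, hψP, hface⟩ := exists_cube_convexHull (Finset.coe_nonempty.2 hne)
      s₀.finite_toSet
    obtain ⟨α, hαo, hα, hαface⟩ := exists_finset_separating_faces hψ hface
    have hcov : IsOpenCoverOf (⋃ s ∈ S, convexHull ℝ (s : Set (EuclideanSpace ℝ (Fin N)))) α :=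
      ⟨hαo, fun x _ => by simpa using hα x⟩
    have := card_le_Dcov hcov hψ (fun x _ => Set.mem_biUnion hs₀ (hψP x)) hαface
    rw [← hcard]
    exact le_trans (by exact_mod_cast this) (le_iSup₂_of_le α hcov le_rfl)

end Polyhedron

section MeanDimension

variable {G : Type*} [Group G]

theorem visits_mul_le [DecidableEq G] (J : Set G) (K F : Finset G) (c : G) :
    visits J (K * F) c ≤ visits J F c + ∑ k ∈ K, escape k F := by
  classical
  have h : (K * F).filter (fun g => g * c ∈ J) ⊆ (F.filter fun g => g * c ∈ J) ∪
      K.biUnion fun k => (F.filter fun f => k * f ∉ F).image (k * ·) := by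
    intro g hg
    obtain ⟨hg, hgJ⟩ := Finset.mem_filter.1 hg
    obtain ⟨k, hk, f, hf, rfl⟩ := Finset.mem_mul.1 hg
    by_cases h : k * f ∈ F
    · exact Finset.mem_union_left _ (Finset.mem_filter.2 ⟨h, hgJ⟩)
    · exact Finset.mem_union_right _ (Finset.mem_biUnion.2 ⟨k, hk,
        Finset.mem_image_of_mem _ (Finset.mem_filter.2 ⟨hf, h⟩)⟩)
  calc visits J (K * F) c ≤ _ := Finset.card_le_card (by convert h)
    _ ≤ _ := Finset.card_union_le _ _
    _ ≤ _ := by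
      gcongr
      · exact le_of_eq (by unfold visits; congr)
      · refine Finset.card_biUnion_le.trans (Finset.sum_le_sum fun k _ => ?_)
        exact Finset.card_image_le.trans (le_of_eq (by unfold escape; congr))

section LowerBound

/-- If all coordinates in `S ⊆ F` are free in `X` and `P` contains a `d`-dimensional cube, the
iterated cover along `F` has order at least `#S * d`. -/
theorem card_mul_le_Dcov_FCover {Q ι : Type*} [TopologicalSpace Q] [Fintype ι] {X : Set (G → Q)}
    (hX : ∀ c : G, Set.MapsTo (shiftAct c) X X) {ψ : (ι → ℝ) → Q} (hψ : Continuous ψ)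
    {α : Finset (Set Q)}
    (hface : ∀ V ∈ α, ∀ i, ∀ x ∈ Set.Icc (0 : ι → ℝ) 1, ∀ x' ∈ Set.Icc (0 : ι → ℝ) 1,
      ψ x ∈ V → ψ x' ∈ V → x i = 0 → x' i ≠ 1)
    {α' : Finset (Set (G → Q))} (hα' : ∀ U ∈ α', ∃ V ∈ α, U = (fun x => x 1) ⁻¹' V)
    (hcov : IsOpenCoverOf X α') {S F : Finset G} (hSF : S ⊆ F) {b : G → Q}
    (hb : ∀ x : G → Q, (∀ g ∉ S, x g = b g) → x ∈ X) :
    S.card * Fintype.card ι ≤ Dcov X (FCover (fun c (x : G → Q) => shiftAct c x) F α') := by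
  classical
  let φ : (S × ι → ℝ) → G → Q := fun a g => if h : g ∈ S then ψ fun i => a (⟨g, h⟩, i) else b g
  have hφ : Continuous φ := by
    refine continuous_pi fun g => ?_
    by_cases h : g ∈ S
    · simp only [φ, h, dif_pos]
      exact hψ.comp (by fun_prop)
    · simp only [φ, h, dif_neg, not_false_eq_true]
      exact continuous_const
  have := card_le_Dcov (hcov.fCover (σ := fun c (x : G → Q) => shiftAct c x) (F := F)
    (fun c => continuous_shiftAct c) hX) hφ (fun x _ => hb _ fun g hg => by simp [φ, hg]) ?_
  · simpa using this
  · rintro U hU ⟨g, i⟩ x hx x' hx' hxU hxU' h0 h1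
    obtain ⟨f, hf, rfl⟩ := exists_of_mem_FCover hU
    obtain ⟨V, hV, hfV⟩ := hα' _ (hf g (hSF g.2))
    have h2 := Set.mem_iInter₂.1 hxU g (hSF g.2)
    have h3 := Set.mem_iInter₂.1 hxU' g (hSF g.2)
    rw [hfV] at h2 h3
    simp only [Set.mem_preimage, shiftAct, one_mul, φ, g.2, dif_pos] at h2 h3
    exact hface V hV i _ ⟨fun i => hx.1 (g, i), fun i => hx.2 (g, i)⟩ _
      ⟨fun i => hx'.1 (g, i), fun i => hx'.2 (g, i)⟩ h2 h3 h0 h1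

theorem ofReal_mul_le_mdim {Q ι : Type*} [TopologicalSpace Q] [T2Space Q] [Fintype ι]
    {X : Set (G → Q)} (hX : ∀ c : G, Set.MapsTo (shiftAct c) X X) {ψ : (ι → ℝ) → Q}
    (hψ : Continuous ψ)
    (hface : ∀ i, ∀ x ∈ Set.Icc (0 : ι → ℝ) 1, ∀ x' ∈ Set.Icc (0 : ι → ℝ) 1,
      ψ x = ψ x' → x i = 0 → x' i ≠ 1) {ρ : ℝ}
    (hfree : ∀ F : Finset G, F.Nonempty → ∃ S ⊆ F, ρ * F.card ≤ S.card ∧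
      ∃ b : G → Q, ∀ x : G → Q, (∀ g ∉ S, x g = b g) → x ∈ X)
    {Fo : ℕ → Finset G} (hFo : IsFolnerSeq G Fo) :
    ENNReal.ofReal ρ * (Fintype.card ι : ℝ≥0∞) ≤
      mdim (fun c (x : G → Q) => shiftAct c x) X Fo := by
  classical
  obtain ⟨α, hαo, hα, hαface⟩ := exists_finset_separating_faces hψ hface
  have hα' : ∀ U ∈ α.image fun V => (fun x : G → Q => x 1) ⁻¹' V,
      ∃ V ∈ α, U = (fun x => x 1) ⁻¹' V := by
    intro U hU
    obtain ⟨V, hV, rfl⟩ := Finset.mem_image.1 hU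
    exact ⟨V, hV, rfl⟩
  have hcov : IsOpenCoverOf X (α.image fun V => (fun x : G → Q => x 1) ⁻¹' V) := by
    refine ⟨fun U hU => ?_, fun x _ => ?_⟩
    · obtain ⟨V, hV, rfl⟩ := hα' U hU
      exact (hαo V hV).preimage (continuous_apply 1)
    · obtain ⟨V, hV, hxV⟩ := hα (x 1)
      exact Set.mem_iUnion₂.2 ⟨_, Finset.mem_image_of_mem _ hV, hxV⟩
  refine le_iSup₂_of_le _ hcov ?_
  rw [← limsup_const (f := (atTop : Filter ℕ)) (ENNReal.ofReal ρ * (Fintype.card ι : ℝ≥0∞))]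
  refine limsup_le_limsup (Eventually.of_forall fun n => ?_)
  obtain ⟨S, hSF, hS, b, hb⟩ := hfree (Fo n) (hFo.1 n)
  have h := card_mul_le_Dcov_FCover hX hψ hαface hα' hcov hSF hb
  rw [ENNReal.le_div_iff_mul_le (Or.inl (by exact_mod_cast (hFo.1 n).card_ne_zero))
    (Or.inl (ENNReal.natCast_ne_top _))]
  calc ENNReal.ofReal ρ * (Fintype.card ι : ℝ≥0∞) * ((Fo n).card : ℝ≥0∞)
      = ENNReal.ofReal (ρ * (Fo n).card) * (Fintype.card ι : ℝ≥0∞) := by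
        rw [ENNReal.ofReal_mul' (Nat.cast_nonneg _), ENNReal.ofReal_natCast]
        ring
    _ ≤ (S.card : ℝ≥0∞) * (Fintype.card ι : ℝ≥0∞) := by
        gcongr
        rw [← ENNReal.ofReal_natCast]
        exact ENNReal.ofReal_le_ofReal hS
    _ ≤ _ := by exact_mod_cast h

end LowerBound

section UpperBound

variable {N : ℕ} {P : Set (EuclideanSpace ℝ (Fin N))}

theorem isInducing_coordinates {I : Type*} :
    IsInducing fun (x : I → P) (i : I × Fin N) => (x i.1 : EuclideanSpace ℝ (Fin N)) i.2 := by
  have h : ∀ g : I, IsInducing fun p : P => (EuclideanSpace.equiv (Fin N) ℝ) p := fun g =>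
    (EuclideanSpace.equiv (Fin N) ℝ).toHomeomorph.isInducing.comp IsInducing.subtypeVal
  have h2 := (IsInducing.piMap h)
  rw [isInducing_iff] at h2 ⊢
  rw [h2]
  simp only [Pi.topologicalSpace, induced_iInf, induced_compose, iInf_prod]
  rfl

open Classical in
/-- If at most `k` of the sites of `K * F` carry a value outside of a finite set, covers
along `F` with Lebesgue window `K` have order at most `k * m`. -/
theorem Dcov_FCover_le {S : Finset (Finset (EuclideanSpace ℝ (Fin N)))}
    (hP : P = ⋃ s ∈ S, convexHull ℝ (s : Set (EuclideanSpace ℝ (Fin N)))) {m : ℕ}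
    (hS : ∀ s ∈ S, Module.finrank ℝ (vectorSpan ℝ (s : Set (EuclideanSpace ℝ (Fin N)))) ≤ m)
    {X : Set (G → P)} (hX : IsCompact X) (hinv : ∀ c : G, Set.MapsTo (shiftAct c) X X)
    {α : Finset (Set (G → P))} {K : Finset (G × Fin N)} {ε : ℝ} (hε : 0 < ε)
    (hK : ∀ x ∈ X, ∃ V ∈ α, ∀ y : G → P, (∀ i ∈ K, |(x i.1 : EuclideanSpace ℝ (Fin N)) i.2 -
      (y i.1 : EuclideanSpace ℝ (Fin N)) i.2| < ε) → y ∈ V)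
    (F : Finset G) {A : Set P} (hA : A.Finite) {k : ℕ}
    (hk : ∀ x ∈ X, ((K.image Prod.fst * F).filter fun g => x g ∉ A).card ≤ k) :
    Dcov X (FCover (fun c (x : G → P) => shiftAct c x) F α) ≤ k * m := by
  obtain ⟨θ, hθ, hθA⟩ := exists_offset S hS (hA.image Subtype.val) hε.ne'
  let L := K.image Prod.fst * F
  refine Dcov_le_of_card_integral_le hX
    (fun (i : L × Fin N) x => ((x i.1 : EuclideanSpace ℝ (Fin N)) i.2 - θ i.2) / ε)
    (fun i => by fun_prop) (fun x hx => ?_) fun x hx => ?_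
  · calc _ ≤ ∑ g : L, if x g ∉ A then m else 0 := by
          rw [Finset.card_filter, Fintype.sum_prod_type]
          refine Finset.sum_le_sum fun g _ => ?_
          rw [← Finset.card_filter]
          by_cases h : x g ∈ A
          · rw [if_neg (not_not.2 h), Nat.le_zero, Finset.card_eq_zero, Finset.filter_eq_empty_iff]
            exact fun j _ => hθA _ ⟨_, h, rfl⟩ j
          · rw [if_pos h]
            exact hθ _ (hP.subset (x g).2)
      _ = (L.filter fun g => x g ∉ A).card * m := by
          rw [Finset.sum_coe_sort L fun g => if x g ∉ A then m else 0, ← Finset.sum_filter,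
            Finset.sum_const, smul_eq_mul]
      _ ≤ k * m := Nat.mul_le_mul_right m (hk x hx)
  · choose V hV hVy using fun g => hK _ (hinv g hx)
    refine ⟨_, biInter_preimage_mem_FCover fun g _ => hV g, fun y hy => ?_⟩
    refine Set.mem_iInter₂.2 fun g hg => hVy g _ fun i hi => ?_
    have := hy (⟨i.1 * g, Finset.mul_mem_mul (Finset.mem_image_of_mem _ hi) hg⟩, i.2)
    rwa [← sub_div, sub_sub_sub_cancel_right, abs_div, abs_of_pos hε, div_lt_one hε] at this

theorem mdim_le {S : Finset (Finset (EuclideanSpace ℝ (Fin N)))}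
    (hP : P = ⋃ s ∈ S, convexHull ℝ (s : Set (EuclideanSpace ℝ (Fin N)))) {m : ℕ}
    (hS : ∀ s ∈ S, Module.finrank ℝ (vectorSpan ℝ (s : Set (EuclideanSpace ℝ (Fin N)))) ≤ m)
    {X : Set (G → P)} (hX : IsCompact X) (hinv : ∀ c : G, Set.MapsTo (shiftAct c) X X) {ρ : ℝ}
    (hρ : 0 ≤ ρ) (hfrozen : ∀ δ > 0, ∃ (A : Set P) (J : Set G), A.Finite ∧
      (∀ x ∈ X, ∀ F : Finset G, ∃ c, ∀ g ∈ F, g * c ∉ J → x g ∈ A) ∧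
      ∃ M : Finset G, M.Nonempty ∧ ∀ c, (visits J M c : ℝ) ≤ (ρ + δ) * M.card)
    {Fo : ℕ → Finset G} (hFo : IsFolnerSeq G Fo) :
    mdim (fun c (x : G → P) => shiftAct c x) X Fo ≤ ENNReal.ofReal ρ * (m : ℝ≥0∞) := by
  classical
  refine iSup₂_le fun α hα => ?_
  obtain ⟨K, ε, hε, hK⟩ := isInducing_coordinates.exists_lebesgue_number
    (f := fun (i : G × Fin N) (x : G → P) => (x i.1 : EuclideanSpace ℝ (Fin N)) i.2) hX hα
  rw [← ENNReal.ofReal_natCast, ← ENNReal.ofReal_mul' (Nat.cast_nonneg _)]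
  have hlim : Tendsto (fun δ : ℝ => ENNReal.ofReal ((ρ + δ + δ + δ) * m)) (𝓝[>] 0)
      (𝓝 (ENNReal.ofReal (ρ * m))) := by
    refine ENNReal.tendsto_ofReal (tendsto_nhdsWithin_of_tendsto_nhds ?_)
    have : Continuous fun δ : ℝ => (ρ + δ + δ + δ) * m := by fun_prop
    simpa using this.tendsto 0
  refine ge_of_tendsto hlim ?_
  filter_upwards [self_mem_nhdsWithin] with δ (hδ : 0 < δ)
  obtain ⟨A, J, hA, hAJ, M, hM, hMJ⟩ := hfrozen δ hδ
  refine limsup_le_of_le (by isBoundedDefault) ?_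
  filter_upwards [hFo.eventually_visits_le hM hMJ hδ,
    hFo.eventually_sum_escape_le (K.image Prod.fst) hδ] with n h1 h2
  have hk : ∀ x ∈ X, ((K.image Prod.fst * Fo n).filter fun g => x g ∉ A).card ≤
      ⌊(ρ + δ + δ + δ) * (Fo n).card⌋₊ := by
    intro x hx
    obtain ⟨c, hc⟩ := hAJ x hx (K.image Prod.fst * Fo n)
    refine Nat.le_floor ?_
    have h3 : ((K.image Prod.fst * Fo n).filter fun g => x g ∉ A).card ≤
        visits J (K.image Prod.fst * Fo n) c := by
      unfold visits
      refine Finset.card_le_card fun g hg => ?_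
      obtain ⟨hg, hgA⟩ := Finset.mem_filter.1 hg
      exact Finset.mem_filter.2 ⟨hg, by_contra fun h => hgA (hc g hg h)⟩
    have h4 : (((K.image Prod.fst * Fo n).filter fun g => x g ∉ A).card : ℝ) ≤
        visits J (Fo n) c + ∑ k ∈ K.image Prod.fst, (escape k (Fo n) : ℝ) := by
      exact_mod_cast h3.trans (visits_mul_le J _ _ c)
    linarith [h1 c]
  have h5 := Dcov_FCover_le hP hS hX hinv hε hK (Fo n) hA hk
  refine ENNReal.div_le_of_le_mul ?_
  rw [← ENNReal.ofReal_natCast (Fo n).card, ← ENNReal.ofReal_mul' (Nat.cast_nonneg _),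
    ← ENNReal.ofReal_natCast]
  refine ENNReal.ofReal_le_ofReal ?_
  calc (Dcov X (FCover (fun c (x : G → P) => shiftAct c x) (Fo n) α) : ℝ)
      ≤ ⌊(ρ + δ + δ + δ) * (Fo n).card⌋₊ * m := by exact_mod_cast h5
    _ ≤ (ρ + δ + δ + δ) * (Fo n).card * m := by
        gcongr
        exact Nat.floor_le (by positivity)
    _ = _ := by ring

end UpperBound

end MeanDimension

/-- Main theorem: minimal subshifts of `P^G` of mean topological
dimension `ρ · dim P` exist for every `0 < ρ < 1`. -/
theorem exists_minimal_subshift_mdim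
    {G : Type*} [Group G] [Countable G] [Infinite G] (hG : IsAmenable G)
    {N : ℕ} (P : Set (EuclideanSpace ℝ (Fin N))) (hP : IsPolyhedron P)
    (hd0 : 0 < topDim P) (hdfin : topDim P < ⊤)
    (ρ : ℝ) (hρ0 : 0 < ρ) (hρ1 : ρ < 1) :
    ∃ X : Set (G → ↥P), X.Nonempty ∧ IsClosed X ∧
      (∀ c : G, shiftAct c '' X = X) ∧
      (∀ y ∈ X, X ⊆ closure (Set.range fun c : G => shiftAct c y)) ∧
      ∀ Fo : ℕ → Finset G, IsFolnerSeq G Fo →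
        mdim (fun c (x : G → ↥P) => shiftAct c x) X Fo =
          ENNReal.ofReal ρ * ENat.toENNReal (topDim P) := by
  classical
  obtain ⟨S, hPS⟩ := hP
  have hne : ∃ s ∈ S, s.Nonempty := by
    by_contra! h
    have hPe : P = ∅ := by
      simp only [hPS, Set.iUnion_eq_empty]
      intro s hs
      simp [h s hs]
    refine hd0.ne' (le_bot_iff.1 (iSup₂_le fun α _ => ?_))
    have h1 : Dcov P α ≤ ordOn P (∅ : Finset (Set (EuclideanSpace ℝ (Fin N)))) :=
      Dcov_le ⟨by simp, by simp [hPe]⟩ (by simp)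
    have h2 : ordOn P (∅ : Finset (Set (EuclideanSpace ℝ (Fin N)))) = 0 :=
      le_antisymm (ciSup_le' fun y => by simp) (Nat.zero_le _)
    rw [h2, Nat.le_zero] at h1
    simp [h1]
  obtain ⟨s, hs, hsne⟩ := hne
  obtain ⟨s₀, hs₀, hmax⟩ := (S.filter Finset.Nonempty).exists_max_image
    (fun s => Module.finrank ℝ (vectorSpan ℝ (s : Set (EuclideanSpace ℝ (Fin N)))))
    ⟨s, Finset.mem_filter.2 ⟨hs, hsne⟩⟩
  obtain ⟨hs₀, hs₀ne⟩ := Finset.mem_filter.1 hs₀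
  have hmax : ∀ s ∈ S, Module.finrank ℝ (vectorSpan ℝ (s : Set (EuclideanSpace ℝ (Fin N)))) ≤
      Module.finrank ℝ (vectorSpan ℝ (s₀ : Set (EuclideanSpace ℝ (Fin N)))) := by
    intro s hs
    rcases s.eq_empty_or_nonempty with rfl | h
    · rw [Finset.coe_empty, vectorSpan_empty, finrank_bot]
      exact Nat.zero_le _
    · exact hmax s (Finset.mem_filter.2 ⟨hs, h⟩)
  have hdim := topDim_biUnion_convexHull S hs₀ hs₀ne hmax
  rw [← hPS] at hdim
  have hsub : convexHull ℝ (s₀ : Set (EuclideanSpace ℝ (Fin N))) ⊆ P := by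
    rw [hPS]
    exact Set.subset_biUnion_of_mem (u := fun s : Finset (EuclideanSpace ℝ (Fin N)) =>
      convexHull ℝ (s : Set (EuclideanSpace ℝ (Fin N)))) hs₀
  have : CompactSpace P := isCompact_iff_compactSpace.1 (hPS ▸ isCompact_biUnion_convexHull S)
  have : Nonempty P := by
    obtain ⟨p, hp⟩ := hs₀ne
    exact ⟨p, hsub (subset_convexHull ℝ _ hp)⟩
  obtain ⟨X, hXne, hXcl, hXinv, hXmin, hfree, hfrozen⟩ :=
    exists_minimal_subshift_freedom (P := P) hG hρ0 hρ1
  have hmaps : ∀ c : G, Set.MapsTo (shiftAct c) X X := fun c =>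
    Set.mapsTo_iff_image_subset.2 (hXinv c).subset
  refine ⟨X, hXne, hXcl, hXinv, hXmin, fun Fo hFo => ?_⟩
  rw [hdim, ENat.toENNReal_coe]
  apply le_antisymm
  · exact mdim_le hPS hmax hXcl.isCompact hmaps hρ0.le hfrozen hFo
  · obtain ⟨ι, _, ψ, hψ, hcard, hψs, hface⟩ :=
      exists_cube_convexHull (Finset.coe_nonempty.2 hs₀ne) s₀.finite_toSet
    rw [← hcard]
    exact ofReal_mul_le_mdim hmaps (ψ := fun a => (⟨ψ a, hsub (hψs a)⟩ : P))
      (hψ.subtype_mk _) (fun i x hx x' hx' h => hface i x hx x' hx' (congrArg Subtype.val h))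
      hfree hFo
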